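/- Let n ≥ 3, let Ω ⊆ ℝⁿ be open, and let u be a smooth solution of −Δu = u|u|^{4/(n−2)} on Ω. There exists a constant C > 0 depending only on n with the following property: if x₀ ∈ Ω and r₀ > 0 are such that the closed ball B(x₀,r₀) ⊆ Ω and E_u(x₀,r₀) ≤ ε for some ε > 0, then for every point x and radius r > 0 with B(x,r) ⊆ B(x₀,r₀) one has ∫_{B(x, r/2)} ( |∇u|² + |u|^{2n/(n−2)} ) dy ≤ C ε. -/

import Mathlib

open MeasureTheory Metric Filter Topology Set
open scoped ENNReal NNReal RealInnerProductSpace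

noncomputable section

abbrev En (n : ℕ) := EuclideanSpace ℝ (Fin n)

/-- The Euclidean Laplacian, as the sum of second directional derivatives. -/
def lap {n : ℕ} (u : En n → ℝ) (x : En n) : ℝ :=
  ∑ i : Fin n, fderiv ℝ (fun y => fderiv ℝ u y (EuclideanSpace.single i 1)) x
    (EuclideanSpace.single i 1)

/-- A smooth solution of the Yamabe-type equation `-Δu = u|u|^{4/(n-2)}` on `Ω`. -/
def IsYamabeSol (n : ℕ) (Ω : Set (En n)) (u : En n → ℝ) : Prop :=
  ContDiffOn ℝ (⊤ : ℕ∞) u Ω ∧ ∀ x ∈ Ω, -lap u x = u x * |u x| ^ ((4 : ℝ) / ((n : ℝ) - 2))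

/-- The monotone quantity `E_u(x,r)`. -/
def Eu (n : ℕ) (u : En n → ℝ) (x : En n) (r : ℝ) : ℝ :=
  (∫ y in closedBall x r,
      ((1 : ℝ) / 2 * ‖gradient u y‖ ^ 2
        - ((n : ℝ) - 2) / (2 * n) * |u y| ^ (2 * (n : ℝ) / ((n : ℝ) - 2))))
  + ((n : ℝ) - 2) / (4 * r) * ∫ y in sphere x r, (u y) ^ 2 ∂(μH[(n : ℝ) - 1])

/-- Outward radial (normal) derivative of `u` on the sphere centered at `x`. -/
def nder {n : ℕ} (u : En n → ℝ) (x z : En n) : ℝ := ⟪gradient u z, z - x⟫ / ‖z - x‖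

/-- Energy density `½|∇u|² + ((n-2)/(2n))|u|^{2n/(n-2)}`. -/
def eDen (n : ℕ) (u : En n → ℝ) (y : En n) : ℝ :=
  (1 : ℝ) / 2 * ‖gradient u y‖ ^ 2
    + ((n : ℝ) - 2) / (2 * n) * |u y| ^ (2 * (n : ℝ) / ((n : ℝ) - 2))

/-- The energy measure `(½|∇u|² + ((n-2)/(2n))|u|^{2n/(n-2)}) dx` on `Ω`. -/
def eMeas (n : ℕ) (Ω : Set (En n)) (u : En n → ℝ) : Measure (En n) :=
  (volume.restrict Ω).withDensity fun y => ENNReal.ofReal (eDen n u y)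

/-- Weak convergence of Radon measures against continuous compactly supported
test functions supported in `Ω`. -/
def WeakConv {n : ℕ} (Ω : Set (En n)) (μs : ℕ → Measure (En n)) (μ : Measure (En n)) : Prop :=
  ∀ φ : En n → ℝ, Continuous φ → HasCompactSupport φ → tsupport φ ⊆ Ω →
    Tendsto (fun i => ∫ y, φ y ∂(μs i)) atTop (𝓝 (∫ y, φ y ∂μ))

/-- Weak convergence in `H¹(Ω)`, tested against continuous compactly supported
functions and vector fields. -/
def WeakH1 {n : ℕ} (Ω : Set (En n)) (us : ℕ → En n → ℝ) (u : En n → ℝ) : Prop :=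
  (∀ φ : En n → ℝ, Continuous φ → HasCompactSupport φ → tsupport φ ⊆ Ω →
    Tendsto (fun i => ∫ y in Ω, us i y * φ y) atTop (𝓝 (∫ y in Ω, u y * φ y))) ∧
  (∀ Φ : En n → En n, Continuous Φ → HasCompactSupport Φ → tsupport Φ ⊆ Ω →
    Tendsto (fun i => ∫ y in Ω, ⟪gradient (us i) y, Φ y⟫) atTop
      (𝓝 (∫ y in Ω, ⟪gradient u y, Φ y⟫)))

/-- `‖u‖_{H¹(Ω)} + ‖u‖_{L^{2n/(n-2)}(Ω)} ≤ Λ`. -/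
def NormBound (n : ℕ) (Ω : Set (En n)) (u : En n → ℝ) (Λ : ℝ) : Prop :=
  (∫ y in Ω, ((u y) ^ 2 + ‖gradient u y‖ ^ 2)) ^ ((1 : ℝ) / 2)
    + (∫ y in Ω, |u y| ^ (2 * (n : ℝ) / ((n : ℝ) - 2))) ^ (((n : ℝ) - 2) / (2 * (n : ℝ))) ≤ Λ

/-- The singular set `Σ = ⋂_{0<r<r₀} {x ∈ Ω : liminf_i E_{uᵢ}(x,r) ≥ ε₀}`. -/
def SingSet (n : ℕ) (Ω : Set (En n)) (us : ℕ → En n → ℝ) (r₀ ε₀ : ℝ) : Set (En n) :=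
  {x ∈ Ω | ∀ r : ℝ, 0 < r → r < r₀ → ε₀ ≤ atTop.liminf fun i => Eu n (us i) x r}



/-- Surface integral over the sphere of centre `c`, radius `r`, in polar form. -/
def SI {n : ℕ} (g : En n → ℝ) (c : En n) (r : ℝ) : ℝ :=
  r ^ (n - 1) * ∫ ω : sphere (0 : En n) 1, g (c + r • (ω : En n)) ∂(volume : Measure (En n)).toSphere

theorem polar_aux {n : ℕ} (hn : 3 ≤ n) (f : En n → ℝ) (hf : Integrable f) :
    IntegrableOn (fun r : ℝ => SI f 0 r) (Ioi 0) ∧ ∫ x, f x = ∫ r in Ioi (0:ℝ), SI f 0 r := by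
  have : Nonempty (Fin n) := ⟨⟨0, by omega⟩⟩
  have hdim : Module.finrank ℝ (En n) = n := by simp
  have hmp := (volume : Measure (En n)).measurePreserving_homeomorphUnitSphereProd
  have hemb : MeasurableEmbedding (homeomorphUnitSphereProd (En n)) :=
    Homeomorph.measurableEmbedding _
  set G : sphere (0 : En n) 1 × Ioi (0:ℝ) → ℝ := fun p => f (p.2.1 • p.1.1) with hG
  have hcomp : ∀ x : ({(0 : En n)}ᶜ : Set (En n)), G (homeomorphUnitSphereProd (En n) x) = f x := by
    intro x
    have hx : ‖(x : En n)‖ ≠ 0 := norm_ne_zero_iff.2 x.2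
    simp [hG, smul_smul, hx]
  have h1 : Integrable G ((volume : Measure (En n)).toSphere.prod (.volumeIoiPow (Module.finrank ℝ (En n) - 1))) := by
    rw [← hmp.integrable_comp_emb hemb]
    have : G ∘ (homeomorphUnitSphereProd (En n)) = f ∘ Subtype.val := by
      ext x; exact hcomp x
    rw [this]
    rw [← MeasurableEmbedding.integrable_map_iff
      (MeasurableEmbedding.subtype_coe (measurableSet_singleton _).compl),
      (MeasurableEmbedding.subtype_coe (measurableSet_singleton _).compl).map_comap]
    exact hf.mono_measure Measure.restrict_le_self
  have h2 : ∫ x, f x = ∫ p, G p ∂((volume : Measure (En n)).toSphere.prod (.volumeIoiPow (Module.finrank ℝ (En n) - 1))) := by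
    rw [← hmp.integral_comp hemb]
    simp_rw [hcomp]
    rw [integral_subtype_comap (measurableSet_singleton _).compl fun x ↦ f x,
        restrict_compl_singleton]
  have h3 : ∫ p, G p ∂((volume : Measure (En n)).toSphere.prod (.volumeIoiPow (Module.finrank ℝ (En n) - 1)))
      = ∫ r : Ioi (0:ℝ), (∫ ω, G (ω, r) ∂(volume : Measure (En n)).toSphere) ∂(.volumeIoiPow (Module.finrank ℝ (En n) - 1)) :=
    integral_prod_symm _ h1
  have h4 := h1.integral_prod_right
  have key : ∀ r : Ioi (0:ℝ), (Real.toNNReal (r.1 ^ (Module.finrank ℝ (En n) - 1))) • (∫ ω, G (ω, r) ∂(volume : Measure (En n)).toSphere) = SI f 0 r := by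
    intro r
    rw [NNReal.smul_def, Real.coe_toNNReal _ (pow_nonneg r.2.out.le _), hdim]
    simp [SI, hG]
  constructor
  · simp only [Measure.volumeIoiPow, ENNReal.ofReal] at h4
    rw [integrable_withDensity_iff_integrable_smul (measurable_subtype_coe.pow_const _).real_toNNReal] at h4
    simp_rw [key] at h4
    have hE : MeasurableEmbedding (Subtype.val : Ioi (0:ℝ) → ℝ) :=
      MeasurableEmbedding.subtype_coe measurableSet_Ioi
    have := hE.integrable_map_iff (g := fun r : ℝ => SI f 0 r) (μ := (.comap Subtype.val volume))
    rw [hE.map_comap, Subtype.range_coe] at this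
    rw [IntegrableOn]
    exact this.2 h4
  · rw [h2, h3]
    simp only [Measure.volumeIoiPow, ENNReal.ofReal]
    rw [integral_withDensity_eq_integral_smul (measurable_subtype_coe.pow_const _).real_toNNReal]
    simp_rw [key]
    rw [integral_subtype_comap measurableSet_Ioi fun a ↦ SI f 0 a]

theorem polar {n : ℕ} (hn : 3 ≤ n) (g : En n → ℝ) (c : En n) {R₁ R₂ : ℝ} (h1 : 0 ≤ R₁) (h2 : R₁ ≤ R₂)
    (hg : IntegrableOn g (closedBall c R₂ \ closedBall c R₁)) :
    IntervalIntegrable (fun r => SI g c r) volume R₁ R₂ ∧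
    ∫ x in closedBall c R₂ \ closedBall c R₁, g x = ∫ r in R₁..R₂, SI g c r := by
  set A := closedBall c R₂ \ closedBall c R₁ with hA
  have hAm : MeasurableSet A := measurableSet_closedBall.diff measurableSet_closedBall
  set f : En n → ℝ := fun z => A.indicator g (c + z) with hf
  have hfi : Integrable f := by
    have := (hg.integrable_indicator hAm).comp_add_left c
    exact this
  have hfint : ∫ x in A, g x = ∫ z, f z := by
    rw [← integral_indicator hAm, ← integral_add_left_eq_self _ c]
  obtain ⟨a, b⟩ := polar_aux hn f hfi
  have hSI : ∀ r ∈ Ioi (0:ℝ), SI f 0 r = (Ioc R₁ R₂).indicator (fun r => SI g c r) r := by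
    intro r hr
    have hr0 : 0 < r := hr
    have hmem : ∀ ω : sphere (0 : En n) 1, c + r • (ω : En n) ∈ A ↔ r ∈ Ioc R₁ R₂ := by
      intro ω
      have : ‖(ω : En n)‖ = 1 := by simp
      simp [hA, norm_smul, this, abs_of_pos hr0, and_comm]
    by_cases hm : r ∈ Ioc R₁ R₂
    · rw [indicator_of_mem hm]
      simp only [SI, hf, zero_add]
      congr 1
      apply integral_congr_ae
      filter_upwards with ω
      rw [indicator_of_mem ((hmem ω).2 hm)]
    · rw [indicator_of_notMem hm]
      simp only [SI, hf, zero_add]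
      have : ∀ ω : sphere (0 : En n) 1, A.indicator g (c + r • (ω : En n)) = 0 := fun ω =>
        indicator_of_notMem (fun h => hm ((hmem ω).1 h)) _
      simp [this]
  have hsub : Ioc R₁ R₂ ∩ Ioi 0 = Ioc R₁ R₂ :=
    inter_eq_left.2 (fun r hr => lt_of_le_of_lt h1 hr.1)
  constructor
  · rw [intervalIntegrable_iff_integrableOn_Ioc_of_le h2]
    have a' := (integrableOn_congr_fun hSI measurableSet_Ioi).1 a
    rw [IntegrableOn, integrable_indicator_iff measurableSet_Ioc, IntegrableOn,
      Measure.restrict_restrict measurableSet_Ioc, hsub] at a'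
    exact a'
  · rw [hfint, b, setIntegral_congr_fun measurableSet_Ioi hSI,
      integral_indicator measurableSet_Ioc, Measure.restrict_restrict measurableSet_Ioc, hsub,
      intervalIntegral.integral_of_le h2]

theorem polar_ball {n : ℕ} (hn : 3 ≤ n) (g : En n → ℝ) (c : En n) {R : ℝ} (h1 : 0 ≤ R)
    (hg : IntegrableOn g (closedBall c R)) :
    IntervalIntegrable (fun r => SI g c r) volume 0 R ∧
    ∫ x in closedBall c R, g x = ∫ r in (0:ℝ)..R, SI g c r := by
  have : Nonempty (Fin n) := ⟨⟨0, by omega⟩⟩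
  have := polar hn g c le_rfl h1 (hg.mono_set sdiff_subset)
  refine ⟨this.1, ?_⟩
  rw [← this.2]
  apply setIntegral_congr_set
  have : (volume : Measure (En n)) (closedBall c 0) = 0 := by simp
  exact (sdiff_null_ae_eq_self this).symm

theorem corner_aux {a b d t s : ℝ} (ha : |a| ≤ d) (hb : |b| ≤ d) (hab : |a - b| ≤ d)
    (ht0 : 0 ≤ t) (ht1 : t ≤ 1) (hs0 : 0 ≤ s) (hs1 : s ≤ 1) : |t * a - s * b| ≤ d := by
  rw [abs_le] at *
  obtain ⟨a1, a2⟩ := ha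
  obtain ⟨b1, b2⟩ := hb
  obtain ⟨c1, c2⟩ := hab
  have hd : 0 ≤ d := by linarith
  have e1 := mul_nonneg (mul_nonneg ht0 hs0) (sub_nonneg.2 c2)
  have e2 := mul_nonneg (mul_nonneg ht0 (sub_nonneg.2 hs1)) (sub_nonneg.2 a2)
  have e3 := mul_nonneg (mul_nonneg (sub_nonneg.2 ht1) hs0) (show 0 ≤ d + b by linarith)
  have e4 := mul_nonneg (mul_nonneg (sub_nonneg.2 ht1) (sub_nonneg.2 hs1)) hd
  have f1 := mul_nonneg (mul_nonneg ht0 hs0) (show 0 ≤ d + (a - b) by linarith)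
  have f2 := mul_nonneg (mul_nonneg ht0 (sub_nonneg.2 hs1)) (show 0 ≤ d + a by linarith)
  have f3 := mul_nonneg (mul_nonneg (sub_nonneg.2 ht1) hs0) (show 0 ≤ d - b by linarith)
  constructor
  · nlinarith
  · nlinarith

/-- Volume of a set is bounded by the product of its widths in an orthonormal basis. -/
theorem vol_le_prod {n : ℕ} (b : OrthonormalBasis (Fin n) ℝ (En n)) (A : Set (En n))
    (w : Fin n → ℝ) (hw : ∀ i, ∀ y ∈ A, ∀ y' ∈ A, |⟪b i, y⟫ - ⟪b i, y'⟫| ≤ w i) :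
    volume A ≤ ∏ i, ENNReal.ofReal (w i) := by
  let e : En n ≃ᵐ (Fin n → ℝ) := b.measurableEquiv.trans (MeasurableEquiv.toLp 2 (Fin n → ℝ)).symm
  have he : MeasurePreserving e volume volume :=
    (EuclideanSpace.volume_preserving_symm_measurableEquiv_toLp (Fin n)).comp
      b.measurePreserving_measurableEquiv
  have hev : ∀ y i, e y i = ⟪b i, y⟫ := by
    intro y i
    exact b.repr_apply_apply y i
  have h1 : volume A = volume (e '' A) := by
    rw [← he.measure_preimage_equiv, preimage_image_eq _ e.injective]
  rw [h1]
  refine (Real.volume_pi_le_prod_diam _).trans (Finset.prod_le_prod' fun i _ => ?_)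
  rw [image_image, ediam_image_le_iff]
  intro y hy y' hy'
  rw [edist_dist]
  apply ENNReal.ofReal_le_ofReal
  rw [Real.dist_eq]
  simpa [hev] using hw i y hy y' hy'

open scoped Pointwise in
theorem shell_bound {n : ℕ} (hn : 3 ≤ n) (s : Set (sphere (0 : En n) 1)) (hs : MeasurableSet s)
    (p : sphere (0 : En n) 1) (hp : p ∈ s) (d h : ℝ) (hd0 : 0 ≤ d) (hh0 : 0 < h) (hh1 : h < 1)
    (hd : ∀ x ∈ s, ∀ y ∈ s, dist x y ≤ d) :
    (volume : Measure (En n)).toSphere.real s * (1 - (1 - h) ^ n) ≤ n * (d ^ (n - 1) * (h + d ^ 2)) := by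
  have hne : Nonempty (Fin n) := ⟨⟨0, by omega⟩⟩
  set i0 : Fin n := ⟨0, by omega⟩
  have hdim : Module.finrank ℝ (En n) = n := by simp
  set S : Set (En n) := (↑) '' s with hS
  have hSn : ∀ ω ∈ S, ‖ω‖ = 1 := by
    rintro _ ⟨ω, _, rfl⟩; simp
  have hSd : ∀ ω ∈ S, ∀ ω' ∈ S, ‖ω - ω'‖ ≤ d := by
    rintro _ ⟨ω, h1, rfl⟩ _ ⟨ω', h2, rfl⟩
    rw [← dist_eq_norm]; exact hd ω h1 ω' h2
  have hpS : (p : En n) ∈ S := ⟨p, hp, rfl⟩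
  set C : Set (En n) := Ioo (0:ℝ) 1 • S with hC
  set D : Set (En n) := (1 - h) • C with hD
  obtain ⟨b, hb⟩ := Orthonormal.exists_orthonormalBasis_extension_of_card_eq (𝕜 := ℝ) (E := En n)
    (ι := Fin n) (by simp) (v := fun _ => (p : En n)) (s := {i0}) (by
      rw [orthonormal_iff_ite]
      rintro ⟨i, rfl⟩ ⟨j, rfl⟩
      simp)
  have hb0 : b i0 = p := hb i0 rfl
  have hshell : ∀ y ∈ C \ D, ∃ t ω, 1 - h ≤ t ∧ t ≤ 1 ∧ ω ∈ S ∧ y = t • ω := by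
    rintro y ⟨hy, hyD⟩
    obtain ⟨t, ht, ω, hω, rfl⟩ := hy
    refine ⟨t, ω, ?_, ht.2.le, hω, rfl⟩
    by_contra hlt
    push Not at hlt
    apply hyD
    have h1h : 0 < 1 - h := by linarith
    refine ⟨(t / (1 - h)) • ω, ⟨t / (1 - h), ⟨div_pos ht.1 h1h, (div_lt_one h1h).2 hlt⟩, ω, hω, rfl⟩, ?_⟩
    simp only [smul_smul]
    congr 1
    field_simp
  have hvol : volume (C \ D) ≤ ∏ i, ENNReal.ofReal (if i = i0 then h + d ^ 2 else d) := by
    apply vol_le_prod b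
    intro i y hy y' hy'
    obtain ⟨t, ω, ht, ht1, hω, rfl⟩ := hshell y hy
    obtain ⟨t', ω', ht', ht1', hω', rfl⟩ := hshell y' hy'
    rw [inner_smul_right, inner_smul_right]
    split_ifs with hi
    · subst hi
      rw [hb0]
      have key : ∀ w ∈ S, 1 - d ^ 2 / 2 ≤ ⟪(p : En n), w⟫ ∧ ⟪(p : En n), w⟫ ≤ 1 := by
        intro w hw
        have h1 := norm_sub_sq_real (p : En n) w
        rw [hSn _ hpS, hSn _ hw] at h1
        have h2 := hSd _ hpS _ hw
        have h3 : ‖(p : En n) - w‖ ^ 2 ≤ d ^ 2 := by gcongr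
        constructor
        · linarith
        · nlinarith [sq_nonneg ‖(p : En n) - w‖]
      obtain ⟨k1, k2⟩ := key ω hω
      obtain ⟨k3, k4⟩ := key ω' hω'
      have g1 : t * ⟪(p : En n), ω⟫ ≤ 1 := by nlinarith
      have g2 : t' * ⟪(p : En n), ω'⟫ ≤ 1 := by nlinarith
      have g3 : 1 - (h + d ^ 2) ≤ t * ⟪(p : En n), ω⟫ := by nlinarith
      have g4 : 1 - (h + d ^ 2) ≤ t' * ⟪(p : En n), ω'⟫ := by nlinarith
      rw [abs_le]; constructor <;> linarith
    · have hpi : ⟪b i, (p : En n)⟫ = 0 := by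
        rw [← hb0]; exact b.orthonormal.2 hi
      have hin : ∀ z : En n, |⟪b i, z⟫| ≤ ‖z‖ := by
        intro z
        have := abs_real_inner_le_norm (b i) z
        rwa [b.orthonormal.1 i, one_mul] at this
      apply corner_aux
      · have := hin (ω - p)
        rw [inner_sub_right, hpi, sub_zero] at this
        exact this.trans (hSd _ hω _ hpS)
      · have := hin (ω' - p)
        rw [inner_sub_right, hpi, sub_zero] at this
        exact this.trans (hSd _ hω' _ hpS)
      · have := hin (ω - ω')
        rw [inner_sub_right] at this
        exact this.trans (hSd _ hω _ hω')
      all_goals linarith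
  have hprod : ∏ i, ENNReal.ofReal (if i = i0 then h + d ^ 2 else d) = ENNReal.ofReal (d ^ (n - 1) * (h + d ^ 2)) := by
    rw [← ENNReal.ofReal_prod_of_nonneg (by intro i _; split_ifs <;> positivity)]
    congr 1
    rw [← Finset.mul_prod_erase _ _ (Finset.mem_univ i0)]
    rw [Finset.prod_congr rfl (g := fun _ => d) (by
      intro i hi; rw [if_neg (Finset.ne_of_mem_erase hi)])]
    simp [Finset.card_erase_of_mem, mul_comm]
  have hCfin : volume C ≠ ⊤ := by
    apply ne_top_of_le_ne_top (measure_ball_lt_top (μ := (volume : Measure (En n))) (x := (0 : En n)) (r := 1)).ne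
    apply measure_mono
    rintro _ ⟨t, ht, ω, hω, rfl⟩
    simp [norm_smul, hSn ω hω, abs_of_pos ht.1, ht.2]
  have hDv : volume D = ENNReal.ofReal ((1 - h) ^ n) * volume C := by
    rw [hD, Measure.addHaar_smul, hdim, abs_of_nonneg (pow_nonneg (by linarith) _)]
  have hle : volume C ≤ ENNReal.ofReal (d ^ (n - 1) * (h + d ^ 2)) + ENNReal.ofReal ((1 - h) ^ n) * volume C := by
    calc volume C ≤ volume ((C \ D) ∪ D) := measure_mono (by intro y hy; by_cases h : y ∈ D <;> simp [h, hy])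
      _ ≤ volume (C \ D) + volume D := measure_union_le _ _
      _ ≤ _ := by rw [hDv, ← hprod]; exact add_le_add hvol le_rfl
  have hσ : (volume : Measure (En n)).toSphere.real s = n * (volume C).toReal := by
    rw [Measure.real, Measure.toSphere_apply' _ hs, hdim]; simp [hC, hS]
  have hle' : (volume C).toReal ≤ d ^ (n - 1) * (h + d ^ 2) + (1 - h) ^ n * (volume C).toReal := by
    have := ENNReal.toReal_mono (ENNReal.add_ne_top.2 ⟨ENNReal.ofReal_ne_top, ENNReal.mul_ne_top ENNReal.ofReal_ne_top hCfin⟩) hle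
    rw [ENNReal.toReal_add ENNReal.ofReal_ne_top (ENNReal.mul_ne_top ENNReal.ofReal_ne_top hCfin),
      ENNReal.toReal_mul, ENNReal.toReal_ofReal (by positivity),
      ENNReal.toReal_ofReal (pow_nonneg (by linarith) _)] at this
    exact this
  rw [hσ]
  have : (0:ℝ) ≤ n := by positivity
  nlinarith

theorem exists_h {n : ℕ} (hn : 3 ≤ n) (θ : ℝ) (hθ : θ < 1) :
    ∃ h : ℝ, 0 < h ∧ h < 1 ∧ θ * (n * h) ≤ 1 - (1 - h) ^ n := by
  have hd : HasDerivAt (fun h : ℝ => 1 - (1 - h) ^ n) n 0 := by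
    have := (((hasDerivAt_id (0:ℝ)).const_sub 1).pow n).const_sub 1
    simpa using this
  have hn0 : (0:ℝ) < n := by positivity
  have h1 := hd.tendsto_slope_zero_right
  have h2 : ∀ᶠ t in 𝓝[>] (0:ℝ), θ * n < t⁻¹ • ((1 - (1 - (0 + t)) ^ n) - (1 - (1 - 0) ^ n)) := 
    h1.eventually (lt_mem_nhds (by nlinarith))
  have h3 : ∀ᶠ t in 𝓝[>] (0:ℝ), t ∈ Ioo (0:ℝ) 1 := Ioo_mem_nhdsGT one_pos
  obtain ⟨t, ht, ht'⟩ := (h2.and h3).exists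
  refine ⟨t, ht'.1, ht'.2, ?_⟩
  simp only [zero_add, sub_zero, one_pow, sub_self, smul_eq_mul] at ht
  rw [inv_mul_eq_div, lt_div_iff₀ ht'.1] at ht
  linarith

theorem theta_le {n : ℕ} (hn : 3 ≤ n) (θ : ℝ) (hθ0 : 0 < θ) (hθ : θ < 1) :
    ENNReal.ofReal θ • (volume : Measure (En n)).toSphere ≤ μH[(n : ℝ) - 1] := by
  obtain ⟨h, hh0, hh1, hh⟩ := exists_h hn ((1 + θ) / 2) (by linarith)
  set θ' := (1 + θ) / 2 with hθ'
  have hn0 : (0:ℝ) < n := by positivity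
  have hq : 0 < h * (θ' / θ - 1) := by
    apply mul_pos hh0
    rw [sub_pos, one_lt_div hθ0]; linarith
  set δ := Real.sqrt (h * (θ' / θ - 1)) with hδ
  have hδ0 : 0 < δ := Real.sqrt_pos.2 hq
  have hδ2 : δ ^ 2 = h * (θ' / θ - 1) := Real.sq_sqrt hq.le
  refine Measure.le_hausdorffMeasure _ _ (ENNReal.ofReal δ) (by simpa using hδ0) ?_
  intro s0 hs0
  rw [← ediam_closure] at hs0 ⊢
  refine (measure_mono subset_closure).trans ?_
  set s := closure s0
  have hs : MeasurableSet s := isClosed_closure.measurableSet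
  rcases s.eq_empty_or_nonempty with he | ⟨p, hp⟩
  · simp [he]
  have hfin : ediam s ≠ ⊤ := ne_top_of_le_ne_top ENNReal.ofReal_ne_top hs0
  set d := (ediam s).toReal with hd
  have hde : ediam s = ENNReal.ofReal d := (ENNReal.ofReal_toReal hfin).symm
  have hd0 : 0 ≤ d := ENNReal.toReal_nonneg
  have hdδ : d ≤ δ := by rwa [hde, ENNReal.ofReal_le_ofReal_iff hδ0.le] at hs0
  have hb := shell_bound hn s hs p hp d h hd0 hh0 hh1 (by
    intro x hx y hy
    have := edist_le_ediam_of_mem hx hy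
    rw [hde, edist_dist, ENNReal.ofReal_le_ofReal_iff hd0] at this
    exact this)
  set σ := (volume : Measure (En n)).toSphere.real s with hσ
  have hσ0 : 0 ≤ σ := measureReal_nonneg
  have h1 : σ * (θ' * (n * h)) ≤ n * (d ^ (n - 1) * (h + d ^ 2)) := le_trans (by gcongr) hb
  have h2 : h + d ^ 2 ≤ h * (θ' / θ) := by
    have : d ^ 2 ≤ δ ^ 2 := by gcongr
    rw [hδ2] at this; linarith
  have hdn : 0 ≤ d ^ (n - 1) := by positivity
  have h3 : σ * (θ' * (n * h)) ≤ n * (d ^ (n - 1) * (h * (θ' / θ))) := le_trans h1 (by gcongr)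
  have hθ'0 : 0 < θ' := by rw [hθ']; linarith
  have h4 : θ * σ ≤ d ^ (n - 1) := by
    have e1 : σ * (θ' * (n * h)) = (θ * σ) * (n * h * (θ' / θ)) := by field_simp
    have e2 : n * (d ^ (n - 1) * (h * (θ' / θ))) = d ^ (n - 1) * (n * h * (θ' / θ)) := by ring
    rw [e1, e2] at h3
    exact le_of_mul_le_mul_right h3 (by positivity)
  have e3 : ediam s ^ ((n:ℝ) - 1) = ENNReal.ofReal (d ^ (n - 1)) := by
    rw [hde, ENNReal.ofReal_pow hd0, ← ENNReal.rpow_natCast]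
    congr 1
    rw [Nat.cast_sub (by omega)]; simp
  rw [e3, Measure.smul_apply, smul_eq_mul, ← ofReal_measureReal, ← ENNReal.ofReal_mul hθ0.le]
  exact ENNReal.ofReal_le_ofReal h4

theorem toSphere_le {n : ℕ} (hn : 3 ≤ n) :
    (volume : Measure (En n)).toSphere ≤ μH[(n : ℝ) - 1] := by
  intro A
  have h1 : Tendsto (fun θ : ℝ => ENNReal.ofReal θ * (volume : Measure (En n)).toSphere A) (𝓝[<] 1)
      (𝓝 (ENNReal.ofReal 1 * (volume : Measure (En n)).toSphere A)) := by
    apply ENNReal.Tendsto.mul_const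
    · exact (ENNReal.continuous_ofReal.tendsto 1).mono_left nhdsWithin_le_nhds
    · right; exact measure_ne_top _ _
  rw [ENNReal.ofReal_one, one_mul] at h1
  refine le_of_tendsto h1 ?_
  filter_upwards [Ioo_mem_nhdsLT (zero_lt_one' ℝ)] with θ hθ
  exact theta_le hn θ hθ.1 hθ.2 A

theorem normalize_lip {n : ℕ} : LipschitzOnWith 2 (fun y : En n => ‖y‖⁻¹ • y) {y | 1 ≤ ‖y‖} := by
  apply LipschitzOnWith.of_dist_le_mul
  intro x hx y hy
  simp only [mem_ofPred_eq] at hx hy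
  rw [dist_eq_norm, dist_eq_norm]
  have hx0 : 0 < ‖x‖ := by linarith
  have hy0 : 0 < ‖y‖ := by linarith
  have e : ‖x‖⁻¹ • x - ‖y‖⁻¹ • y = ‖x‖⁻¹ • (x - y) + ((‖y‖ - ‖x‖) * ‖x‖⁻¹ * ‖y‖⁻¹) • y := by
    have : (‖y‖ - ‖x‖) * ‖x‖⁻¹ * ‖y‖⁻¹ = ‖x‖⁻¹ - ‖y‖⁻¹ := by field_simp
    rw [this]; module
  have h1 : ‖‖x‖⁻¹ • (x - y)‖ ≤ ‖x - y‖ := by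
    rw [norm_smul, norm_inv, norm_norm]
    have : ‖x‖⁻¹ ≤ 1 := inv_le_one_of_one_le₀ hx
    nlinarith [norm_nonneg (x - y)]
  have h2 : ‖((‖y‖ - ‖x‖) * ‖x‖⁻¹ * ‖y‖⁻¹) • y‖ ≤ ‖x - y‖ := by
    rw [norm_smul, norm_mul, norm_mul, norm_inv, norm_inv, norm_norm, norm_norm, mul_assoc, 
      inv_mul_cancel₀ hy0.ne', mul_one]
    have h3 : ‖‖y‖ - ‖x‖‖ ≤ ‖x - y‖ := by rw [norm_sub_rev x y]; exact abs_norm_sub_norm_le y x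
    have : ‖x‖⁻¹ ≤ 1 := inv_le_one_of_one_le₀ hx
    nlinarith [norm_nonneg (‖y‖ - ‖x‖)]
  rw [e]
  refine (norm_add_le _ _).trans ?_
  simp only [NNReal.coe_ofNat]
  linarith

theorem hausdorff_sphere_lt_top {n : ℕ} (hn : 3 ≤ n) :
    μH[(n : ℝ) - 1] (sphere (0 : En n) 1) < ⊤ := by
  obtain ⟨m, rfl⟩ : ∃ m, n = m + 1 := ⟨n - 1, by omega⟩
  have hcast : (((m + 1 : ℕ) : ℝ) - 1) = (Fintype.card (Fin m) : ℝ) := by simp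
  rw [hcast]
  set Q : Set (Fin m → ℝ) := closedBall 0 1 with hQ
  let F : Fin (m+1) × Bool → (Fin m → ℝ) → En (m+1) := fun p w =>
    WithLp.toLp 2 (p.1.insertNth (if p.2 then 1 else -1) w : Fin (m+1) → ℝ)
  let Nz : En (m+1) → En (m+1) := fun y => ‖y‖⁻¹ • y
  have hFn : ∀ p w, 1 ≤ ‖F p w‖ := by
    intro p w
    have h := PiLp.norm_apply_le (F p w) p.1
    have : ‖(F p w) p.1‖ = 1 := by
      simp only [F, Fin.insertNth_apply_same]
      split_ifs <;> simp
    rw [this] at h; exact h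
  have hFl : ∀ p, ∃ K, LipschitzWith K (F p) := by
    intro p
    have h1 : LipschitzWith 1 (fun w : Fin m → ℝ => (p.1.insertNth (if p.2 then 1 else -1) w : Fin (m+1) → ℝ)) := by
      apply LipschitzWith.of_dist_le_mul
      intro x y
      rw [NNReal.coe_one, one_mul, dist_pi_le_iff dist_nonneg, Fin.forall_iff_succAbove p.1]
      constructor
      · simp
      · intro i; simp only [Fin.insertNth_apply_succAbove]; exact dist_le_pi_dist x y i
    exact ⟨_, (PiLp.lipschitzWith_toLp 2 (fun _ : Fin (m+1) => ℝ)).comp h1⟩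
  have hsub : sphere (0 : En (m+1)) 1 ⊆ ⋃ p ∈ (univ : Set (Fin (m+1) × Bool)), Nz '' (F p '' Q) := by
    intro y hy
    have hy1 : ‖y‖ = 1 := by simpa using hy
    obtain ⟨i, -, hi⟩ := Finset.exists_max_image Finset.univ (fun i => |y i|) ⟨0, Finset.mem_univ _⟩
    have hi0 : 0 < |y i| := by
      rw [abs_pos]
      intro h0
      have : y = 0 := by
        ext j
        have := hi j (Finset.mem_univ _)
        rw [h0, abs_zero] at this
        simpa using this
      rw [this] at hy1; simp at hy1
    simp only [mem_univ, iUnion_true, mem_iUnion]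
    refine ⟨(i, decide (0 < y i)), F (i, decide (0 < y i)) (fun j => y (i.succAbove j) / |y i|), ⟨_, ?_, rfl⟩, ?_⟩
    · simp only [hQ, mem_closedBall_zero_iff]
      rw [pi_norm_le_iff_of_nonneg zero_le_one]
      intro j
      rw [norm_div, Real.norm_eq_abs, Real.norm_eq_abs, abs_abs, div_le_one hi0]
      exact hi _ (Finset.mem_univ _)
    · have hF : F (i, decide (0 < y i)) (fun j => y (i.succAbove j) / |y i|) = |y i|⁻¹ • y := by
        ext k
        revert k
        rw [Fin.forall_iff_succAbove i]
        constructor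
        · simp only [F, Fin.insertNth_apply_same, PiLp.smul_apply, smul_eq_mul]
          by_cases h : 0 < y i
          · simp [h, abs_of_pos h, h.ne']
          · have h' : y i < 0 := lt_of_le_of_ne (not_lt.1 h) (abs_pos.1 hi0)
            simp only [h, decide_false, abs_of_neg h']
            field_simp; simp [h'.ne]
        · intro j
          simp [F, div_eq_inv_mul]
      simp only [Nz, hF]
      rw [norm_smul, hy1, norm_inv, Real.norm_eq_abs, abs_abs, mul_one, inv_inv, smul_smul,
        mul_inv_cancel₀ hi0.ne', one_smul]
  refine lt_of_le_of_lt (measure_mono hsub) ?_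
  refine measure_biUnion_lt_top finite_univ fun p _ => ?_
  obtain ⟨K, hK⟩ := hFl p
  have h1 := (hK.lipschitzOnWith (s := Q)).hausdorffMeasure_image_le (d := (Fintype.card (Fin m) : ℝ)) (by positivity)
  have h2 := ((normalize_lip (n := m+1)).mono (show F p '' Q ⊆ _ by rintro _ ⟨w, _, rfl⟩; exact hFn p w)).hausdorffMeasure_image_le (d := (Fintype.card (Fin m) : ℝ)) (by positivity)
  refine lt_of_le_of_lt h2 (ENNReal.mul_lt_top (ENNReal.rpow_lt_top_of_nonneg (by positivity) ENNReal.coe_ne_top) (lt_of_le_of_lt h1 (ENNReal.mul_lt_top (ENNReal.rpow_lt_top_of_nonneg (by positivity) ENNReal.coe_ne_top) ?_)))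
  rw [hausdorffMeasure_pi_real]
  exact measure_closedBall_lt_top

open scoped Pointwise in
theorem SI_le_hausdorff {n : ℕ} (hn : 3 ≤ n) (g : En n → ℝ) (c : En n) {r : ℝ} (hr : 0 < r)
    (hg0 : ∀ y, 0 ≤ g y) (hg : ContinuousOn g (sphere c r)) :
    SI g c r ≤ ∫ y in sphere c r, g y ∂(μH[(n : ℝ) - 1]) := by
  have hd : 0 ≤ (n : ℝ) - 1 := by
    have : (3:ℝ) ≤ n := by exact_mod_cast hn
    linarith
  set φ : sphere (0 : En n) 1 → En n := fun ω => c + r • (ω : En n) with hφ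
  have hφc : Continuous φ := by fun_prop
  have hφm : ∀ ω, φ ω ∈ sphere c r := by
    intro ω; simp [hφ, norm_smul, abs_of_pos hr]
  have hiso : Isometry (Subtype.val : sphere (0 : En n) 1 → En n) := isometry_subtype_coe
  have : IsFiniteMeasure (μH[(n : ℝ) - 1] : Measure (sphere (0 : En n) 1)) := by
    constructor
    have := hiso.hausdorffMeasure_image (d := (n : ℝ) - 1) (Or.inl hd) univ
    rw [← this]
    rw [image_univ, Subtype.range_coe]
    exact hausdorff_sphere_lt_top hn
  have hmeas : (μH[(n : ℝ) - 1] : Measure (En n)).restrict (sphere c r)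
      = ENNReal.ofReal (r ^ (n - 1)) • Measure.map φ μH[(n : ℝ) - 1] := by
    ext A hA
    rw [Measure.restrict_apply hA, Measure.smul_apply, Measure.map_apply hφc.measurable hA,
      ← hiso.hausdorffMeasure_image (d := (n : ℝ) - 1) (Or.inl hd)]
    have hset : A ∩ sphere c r = (fun y => c + y) '' (r • (Subtype.val '' (φ ⁻¹' A))) := by
      ext y
      constructor
      · rintro ⟨hyA, hy⟩
        have hy' : ‖y - c‖ = r := by simpa [dist_eq_norm] using hy
        refine ⟨y - c, ⟨r⁻¹ • (y - c), ⟨⟨r⁻¹ • (y - c), ?_⟩, ?_, rfl⟩, ?_⟩, by simp⟩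
        · simp [norm_smul, hy', abs_of_pos hr, hr.ne']
        · simp [hφ, smul_smul, hr.ne', hyA]
        · simp [smul_smul, hr.ne']
      · rintro ⟨_, ⟨_, ⟨ω, hω, rfl⟩, rfl⟩, rfl⟩
        exact ⟨hω, hφm ω⟩
    rw [hset, (isometry_add_left c).hausdorffMeasure_image (Or.inl hd), Measure.hausdorffMeasure_smul₀ hd hr.ne',
      ENNReal.smul_def, smul_eq_mul, smul_eq_mul]
    congr 1
    rw [← ENNReal.ofReal_coe_nnreal]
    congr 1
    rw [NNReal.coe_rpow, coe_nnnorm, Real.norm_of_nonneg hr.le, ← Real.rpow_natCast]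
    congr 1
    rw [Nat.cast_sub (by omega)]; simp
  have hgm : AEStronglyMeasurable g (Measure.map φ μH[(n : ℝ) - 1]) := by
    have h1 : AEStronglyMeasurable g ((Measure.map φ μH[(n : ℝ) - 1]).restrict (sphere c r)) :=
      hg.aestronglyMeasurable isClosed_sphere.measurableSet
    rwa [Measure.restrict_eq_self_of_ae_mem] at h1
    exact (ae_map_iff hφc.aemeasurable (p := fun y => y ∈ sphere c r) isClosed_sphere.measurableSet).2 (Eventually.of_forall hφm)
  rw [hmeas, integral_smul_measure, integral_map hφc.aemeasurable hgm,
    ENNReal.toReal_ofReal (by positivity), smul_eq_mul, SI]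
  have hcont : Continuous (fun ω => g (φ ω)) :=
    hg.comp_continuous hφc hφm
  apply mul_le_mul_of_nonneg_left _ (by positivity)
  exact integral_mono_measure (toSphere_le hn) (Eventually.of_forall fun ω => hg0 _)
    (hcont.integrable_of_hasCompactSupport (HasCompactSupport.of_compactSpace _))

theorem hasDerivAt_posSq (s : ℝ) : HasDerivAt (fun s : ℝ => (max s 0) ^ 2) (2 * max s 0) s := by
  rcases lt_trichotomy s 0 with h | h | h
  · rw [max_eq_right h.le, mul_zero]
    refine (hasDerivAt_const s (0:ℝ)).congr_of_eventuallyEq ?_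
    filter_upwards [Iio_mem_nhds h] with t ht
    rw [max_eq_right (le_of_lt ht)]; simp
  · subst h
    simp only [max_self, mul_zero]
    rw [hasDerivAt_iff_isLittleO_nhds_zero]
    simp only [zero_add, max_self, smul_zero, sub_zero]
    have h1 : (fun t : ℝ => max t 0 ^ 2 - 0 ^ 2) =O[𝓝 0] (fun t : ℝ => t ^ 2) := by
      apply Asymptotics.IsBigO.of_bound 1
      refine Eventually.of_forall fun t => ?_
      rw [one_mul, Real.norm_eq_abs, Real.norm_eq_abs, abs_of_nonneg (by nlinarith [sq_nonneg (max t 0)]), abs_of_nonneg (by positivity)]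
      rcases le_total t 0 with h | h
      · rw [max_eq_right h]; nlinarith
      · rw [max_eq_left h]; simp
    exact h1.trans_isLittleO (Asymptotics.isLittleO_pow_id (by norm_num))
  · rw [max_eq_left h.le]
    have := hasDerivAt_pow 2 s
    simp only [Nat.cast_ofNat, Nat.add_one_sub_one, pow_one] at this
    refine this.congr_of_eventuallyEq ?_
    filter_upwards [Ioi_mem_nhds h] with t ht
    rw [max_eq_left (le_of_lt ht)]

theorem SI_congr {n : ℕ} {g g' : En n → ℝ} {c : En n} {r : ℝ} (hr : 0 ≤ r)
    (h : ∀ y ∈ sphere c r, g y = g' y) : SI g c r = SI g' c r := by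
  unfold SI
  congr 1
  apply integral_congr_ae
  refine Eventually.of_forall fun ω => h _ ?_
  simp [norm_smul, abs_of_nonneg hr]

theorem SI_continuous {n : ℕ} {g : En n → ℝ} (hg : Continuous g) (c : En n) :
    Continuous (fun r => SI g c r) := by
  unfold SI
  refine (continuous_pow _).mul ?_
  have := continuous_parametric_integral_of_continuous (μ := (volume : Measure (En n)).toSphere)
    (f := fun (r : ℝ) (ω : sphere (0 : En n) 1) => g (c + r • (ω : En n))) (by
      apply hg.comp
      fun_prop) isCompact_univ
  simpa using this

theorem SI_radial {n : ℕ} {g : En n → ℝ} {c : En n} {r : ℝ} (hr : 0 ≤ r) (f : ℝ → ℝ) :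
    SI (fun y => f ‖y - c‖ * g y) c r = f r * SI g c r := by
  rw [SI_congr hr (g' := fun y => f r * g y)]
  · simp only [SI, integral_const_mul]; ring
  · intro y hy
    have : ‖y - c‖ = r := by simpa [dist_eq_norm] using hy
    rw [this]

theorem ibp_psi {n : ℕ} (hn : 3 ≤ n) {g : En n → ℝ} (hg : ContDiff ℝ 1 g) (c v : En n) {R : ℝ} (hR : 0 < R) :
    ∫ r in (0:ℝ)..R, (R ^ 2 - r ^ 2) ^ 2 * SI (fun y => fderiv ℝ g y v) c r =
      4 * ∫ r in (0:ℝ)..R, (R ^ 2 - r ^ 2) * SI (fun y => g y * ⟪y - c, v⟫) c r := by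
  set ψ : En n → ℝ := fun y => (max (R ^ 2 - ‖y - c‖ ^ 2) 0) ^ 2 with hψ
  have hψd : ∀ y, HasFDerivAt ψ ((2 * max (R ^ 2 - ‖y - c‖ ^ 2) 0) • (-((2:ℝ) • (innerSL ℝ (y - c))))) y := by
    intro y
    have h1 : HasFDerivAt (fun y : En n => R ^ 2 - ‖y - c‖ ^ 2) (-((2:ℝ) • (innerSL ℝ (y - c)))) y := by
      have := (hasFDerivAt_sub_const (x := y) c).norm_sq.const_sub (R^2)
      refine this.congr_fderiv ?_
      ext w; simp
    exact (hasDerivAt_posSq _).comp_hasFDerivAt y h1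
  have hψf : ∀ y, fderiv ℝ ψ y v = -4 * max (R ^ 2 - ‖y - c‖ ^ 2) 0 * ⟪y - c, v⟫ := by
    intro y
    rw [(hψd y).fderiv]
    simp only [ContinuousLinearMap.smul_apply, ContinuousLinearMap.neg_apply, innerSL_apply_apply, smul_eq_mul]
    ring
  have hψc : Continuous ψ := by fun_prop
  have hfc : Continuous (fun y => fderiv ℝ ψ y v) := by
    simp_rw [hψf]; fun_prop
  have hsupp : HasCompactSupport ψ := by
    apply HasCompactSupport.intro (isCompact_closedBall c R)
    intro y hy
    have : R < ‖y - c‖ := by simpa [dist_eq_norm] using hy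
    simp only [hψ]
    rw [max_eq_right (by nlinarith)]; simp
  have hgd : Continuous (fun y => fderiv ℝ g y v) := (hg.continuous_fderiv one_ne_zero).clm_apply continuous_const
  have hgc := hg.continuous
  have key := integral_mul_fderiv_eq_neg_fderiv_mul_of_integrable (μ := (volume : Measure (En n))) (f := ψ) (g := g) (v := v)
    ((hfc.mul hgc).integrable_of_hasCompactSupport ((hsupp.fderiv_apply ℝ v).mul_right))
    ((hψc.mul hgd).integrable_of_hasCompactSupport hsupp.mul_right)
    ((hψc.mul hgc).integrable_of_hasCompactSupport hsupp.mul_right)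
    (fun x _ => (hψd x).differentiableAt) (fun x _ => (hg.differentiable one_ne_zero x))
  have r1 : ∫ x, ψ x * fderiv ℝ g x v = ∫ x in closedBall c R, (fun t : ℝ => (R ^ 2 - t ^ 2) ^ 2) ‖x - c‖ * fderiv ℝ g x v := by
    rw [← integral_indicator measurableSet_closedBall]
    congr 1; ext x
    by_cases hx : x ∈ closedBall c R
    · rw [indicator_of_mem hx]
      have : ‖x - c‖ ≤ R := by simpa [dist_eq_norm] using hx
      simp only [hψ]
      rw [max_eq_left]
      nlinarith [norm_nonneg (x - c)]
    · rw [indicator_of_notMem hx]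
      have : R < ‖x - c‖ := by simpa [dist_eq_norm] using hx
      simp only [hψ]
      rw [max_eq_right (by nlinarith)]; simp
  have r2 : -∫ x, fderiv ℝ ψ x v * g x = 4 * ∫ x in closedBall c R, (fun t : ℝ => (R ^ 2 - t ^ 2)) ‖x - c‖ * (g x * ⟪x - c, v⟫) := by
    rw [← integral_indicator measurableSet_closedBall, ← integral_neg, ← integral_const_mul]
    congr 1; ext x
    rw [hψf]
    by_cases hx : x ∈ closedBall c R
    · rw [indicator_of_mem hx]
      have : ‖x - c‖ ≤ R := by simpa [dist_eq_norm] using hx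
      simp only []
      rw [max_eq_left]
      · ring
      · nlinarith [norm_nonneg (x - c)]
    · rw [indicator_of_notMem hx]
      have : R < ‖x - c‖ := by simpa [dist_eq_norm] using hx
      rw [max_eq_right (by nlinarith)]; simp
  rw [r1, r2] at key
  rw [(polar_ball hn _ c hR.le ?_).2, (polar_ball hn _ c hR.le ?_).2] at key
  · have q1 : ∫ r in (0:ℝ)..R, SI (fun x => (fun t : ℝ => (R ^ 2 - t ^ 2) ^ 2) ‖x - c‖ * fderiv ℝ g x v) c r
        = ∫ r in (0:ℝ)..R, (R ^ 2 - r ^ 2) ^ 2 * SI (fun y => fderiv ℝ g y v) c r := by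
      apply intervalIntegral.integral_congr
      intro r hr
      rw [uIcc_of_le hR.le] at hr
      exact SI_radial hr.1 (fun t => (R ^ 2 - t ^ 2) ^ 2)
    have q2 : ∫ r in (0:ℝ)..R, SI (fun x => (fun t : ℝ => (R ^ 2 - t ^ 2)) ‖x - c‖ * (g x * ⟪x - c, v⟫)) c r
        = ∫ r in (0:ℝ)..R, (R ^ 2 - r ^ 2) * SI (fun y => g y * ⟪y - c, v⟫) c r := by
      apply intervalIntegral.integral_congr
      intro r hr
      rw [uIcc_of_le hR.le] at hr
      exact SI_radial hr.1 (fun t => R ^ 2 - t ^ 2)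
    rw [q1, q2] at key
    exact key
  · apply ContinuousOn.integrableOn_compact (isCompact_closedBall _ _); apply Continuous.continuousOn; fun_prop
  · apply ContinuousOn.integrableOn_compact (isCompact_closedBall _ _); apply Continuous.continuousOn; fun_prop

theorem gauss_scalar {n : ℕ} (hn : 3 ≤ n) {g : En n → ℝ} (hg : ContDiff ℝ 1 g) (c v : En n) {R : ℝ} (hR : 0 < R) :
    ∫ y in closedBall c R, fderiv ℝ g y v = SI (fun y => g y * (⟪y - c, v⟫ / R)) c R := by
  have hgd : Continuous (fun y => fderiv ℝ g y v) := (hg.continuous_fderiv one_ne_zero).clm_apply continuous_const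
  have hgc := hg.continuous
  set h : ℝ → ℝ := fun r => SI (fun y => fderiv ℝ g y v) c r with hh
  set k : ℝ → ℝ := fun r => SI (fun y => g y * ⟪y - c, v⟫) c r with hk
  have hhc : Continuous h := SI_continuous hgd c
  have hkc : Continuous k := SI_continuous (by fun_prop) c
  have hF : ∀ f : ℝ → ℝ, Continuous f → ∀ R, HasDerivAt (fun R => ∫ r in (0:ℝ)..R, f r) (f R) R :=
    fun f hf R => intervalIntegral.integral_hasDerivAt_right (hf.intervalIntegrable _ _) 
      (hf.stronglyMeasurableAtFilter _ _) hf.continuousAt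
  set H0 : ℝ → ℝ := fun R => ∫ r in (0:ℝ)..R, h r
  set H2 : ℝ → ℝ := fun R => ∫ r in (0:ℝ)..R, r ^ 2 * h r
  set H4 : ℝ → ℝ := fun R => ∫ r in (0:ℝ)..R, r ^ 4 * h r
  set K0 : ℝ → ℝ := fun R => ∫ r in (0:ℝ)..R, k r
  set K2 : ℝ → ℝ := fun R => ∫ r in (0:ℝ)..R, r ^ 2 * k r
  have dH0 := hF h hhc
  have dH2 := hF (fun r => r ^ 2 * h r) (by fun_prop)
  have dH4 := hF (fun r => r ^ 4 * h r) (by fun_prop)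
  have dK0 := hF k hkc
  have dK2 := hF (fun r => r ^ 2 * k r) (by fun_prop)
  have id1 : ∀ R, 0 < R → R ^ 4 * H0 R - 2 * R ^ 2 * H2 R + H4 R = 4 * (R ^ 2 * K0 R - K2 R) := by
    intro R hR
    have e := ibp_psi hn hg c v hR
    have e1 : ∫ r in (0:ℝ)..R, (R ^ 2 - r ^ 2) ^ 2 * SI (fun y => fderiv ℝ g y v) c r
        = R ^ 4 * H0 R - 2 * R ^ 2 * H2 R + H4 R := by
      simp only [H0, H2, H4]
      rw [← intervalIntegral.integral_const_mul, ← intervalIntegral.integral_const_mul,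
        ← intervalIntegral.integral_sub, ← intervalIntegral.integral_add]
      · congr 1; ext r; simp only [hh]; ring
      all_goals apply Continuous.intervalIntegrable; fun_prop
    have e2 : ∫ r in (0:ℝ)..R, (R ^ 2 - r ^ 2) * SI (fun y => g y * ⟪y - c, v⟫) c r
        = R ^ 2 * K0 R - K2 R := by
      simp only [K0, K2]
      rw [← intervalIntegral.integral_const_mul, ← intervalIntegral.integral_sub]
      · congr 1; ext r; simp only [hk]; ring
      all_goals apply Continuous.intervalIntegrable; fun_prop
    rw [e1, e2] at e; exact e
  have id2 : ∀ R, 0 < R → R ^ 2 * H0 R - H2 R = 2 * K0 R := by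
    intro R hR
    have d1 := (((hasDerivAt_pow 4 R).mul (dH0 R)).sub (((hasDerivAt_pow 2 R).const_mul 2).mul (dH2 R))).add (dH4 R)
    have d2 := ((((hasDerivAt_pow 2 R).mul (dK0 R)).sub (dK2 R)).const_mul 4)
    have d3 := d2.congr_of_eventuallyEq (f₁ := fun R => R ^ 4 * H0 R - 2 * R ^ 2 * H2 R + H4 R) (by
      filter_upwards [Ioi_mem_nhds hR] with t ht using id1 t ht)
    have := d1.unique d3
    simp only [Nat.cast_ofNat] at this
    have h8 : (4 * R) * (R ^ 2 * H0 R - H2 R) = (4 * R) * (2 * K0 R) := by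
      simp only [H0, H2, K0]
      norm_num at this
      linarith
    exact mul_left_cancel₀ (by positivity) h8
  have id3 : R * H0 R = k R := by
    have d1 := ((hasDerivAt_pow 2 R).mul (dH0 R)).sub (dH2 R)
    have d2 := (dK0 R).const_mul 2
    have d3 := d2.congr_of_eventuallyEq (f₁ := fun R => R ^ 2 * H0 R - H2 R) (by
      filter_upwards [Ioi_mem_nhds hR] with t ht using id2 t ht)
    have := d1.unique d3
    simp only [H0]
    norm_num at this
    linarith
  rw [(polar_ball hn _ c hR.le (hgd.continuousOn.integrableOn_compact (isCompact_closedBall _ _))).2]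
  have : (fun y => g y * (⟪y - c, v⟫ / R)) = fun y => (fun _ : ℝ => 1 / R) ‖y - c‖ * (g y * ⟪y - c, v⟫) := by
    ext y; ring
  rw [this, SI_radial hR.le (fun _ => 1 / R)]
  change H0 R = 1 / R * k R
  rw [← id3]; field_simp

/-- Divergence of a vector field. -/
def dv {n : ℕ} (G : En n → En n) (y : En n) : ℝ :=
  ∑ i : Fin n, ⟪fderiv ℝ G y (EuclideanSpace.single i 1), EuclideanSpace.single i 1⟫

theorem dv_congr {n : ℕ} {G G' : En n → En n} {y : En n} (h : G =ᶠ[𝓝 y] G') : dv G y = dv G' y := by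
  unfold dv; rw [h.fderiv_eq]

theorem dv_continuousOn {n : ℕ} {G : En n → En n} {U : Set (En n)} (hU : IsOpen U)
    (hG : ContDiffOn ℝ 1 G U) : ContinuousOn (dv G) U := by
  unfold dv
  have := hG.continuousOn_fderiv_of_isOpen hU le_rfl
  refine continuousOn_finsetSum _ fun i _ => ?_
  exact (this.clm_apply continuousOn_const).inner continuousOn_const

theorem gauss_global {n : ℕ} (hn : 3 ≤ n) {G : En n → En n} (hG : ContDiff ℝ 1 G) (c : En n) {R : ℝ} (hR : 0 < R) :
    ∫ y in closedBall c R, dv G y = SI (fun y => ⟪G y, y - c⟫ / R) c R := by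
  set e : Fin n → En n := fun i => EuclideanSpace.single i 1 with he
  have hg : ∀ i, ContDiff ℝ 1 (fun y => ⟪G y, e i⟫) := fun i => hG.inner ℝ contDiff_const
  have hd : ∀ y i, ⟪fderiv ℝ G y (e i), e i⟫ = fderiv ℝ (fun y => ⟪G y, e i⟫) y (e i) := by
    intro y i
    rw [fderiv_inner_apply ℝ (hG.differentiable one_ne_zero y) (differentiableAt_const _)]
    simp
  change ∫ y in closedBall c R, ∑ i, ⟪fderiv ℝ G y (e i), e i⟫ = _
  rw [integral_finsetSum]
  · simp_rw [hd]
    have := fun i => gauss_scalar hn (hg i) c (e i) hR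
    simp_rw [this]
    simp only [SI]
    rw [← Finset.mul_sum]
    congr 1
    rw [← integral_finsetSum]
    · congr 1
      ext ω
      have := (EuclideanSpace.basisFun (Fin n) ℝ).sum_inner_mul_inner (G (c + R • (ω : En n))) (c + R • (ω : En n) - c)
      simp only [EuclideanSpace.basisFun_apply] at this
      rw [← this, Finset.sum_div]
      refine Finset.sum_congr rfl fun i _ => ?_
      rw [real_inner_comm (e i) (c + R • (ω : En n) - c)]
      ring
    · intro i _
      have h1 := (hg i).continuous
      apply Continuous.integrable_of_hasCompactSupport _ (HasCompactSupport.of_compactSpace _)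
      fun_prop
  · intro i _
    apply ContinuousOn.integrableOn_compact (isCompact_closedBall _ _)
    apply Continuous.continuousOn
    exact ((hG.continuous_fderiv one_ne_zero).clm_apply continuous_const).inner continuous_const

theorem exists_ext {n : ℕ} {G : En n → En n} {U K : Set (En n)} (hU : IsOpen U) (hK : IsClosed K) (hKU : K ⊆ U)
    (hG : ContDiffOn ℝ 1 G U) : ∃ G', ContDiff ℝ 1 G' ∧ ∀ y ∈ K, G' =ᶠ[𝓝 y] G := by
  obtain ⟨f, h0, h1, -⟩ := exists_contMDiffMap_zero_one_nhds_of_isClosed (n := (1 : ℕ∞)) (modelWithCornersSelf ℝ (En n)) hU.isClosed_compl hK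
    (disjoint_compl_left_iff_subset.2 hKU)
  have hf : ContDiff ℝ 1 f := f.contMDiff.contDiff
  refine ⟨fun y => f y • G y, ?_, ?_⟩
  · rw [contDiff_iff_contDiffAt]
    intro y
    by_cases hy : y ∈ U
    · exact hf.contDiffAt.smul (hG.contDiffAt (hU.mem_nhds hy))
    · have := (h0.filter_mono (nhds_le_nhdsSet (show y ∈ Uᶜ from hy)))
      refine (contDiffAt_const (c := (0 : En n))).congr_of_eventuallyEq ?_
      filter_upwards [this] with z hz
      simp [hz]
  · intro y hy
    filter_upwards [h1.filter_mono (nhds_le_nhdsSet hy)] with z hz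
    simp [hz]

theorem gauss_ball {n : ℕ} (hn : 3 ≤ n) {G : En n → En n} {U : Set (En n)} (hU : IsOpen U)
    (hG : ContDiffOn ℝ 1 G U) (c : En n) {R : ℝ} (hR : 0 < R) (hB : closedBall c R ⊆ U) :
    ∫ y in closedBall c R, dv G y = SI (fun y => ⟪G y, y - c⟫ / R) c R := by
  obtain ⟨G', h1, h2⟩ := exists_ext hU isClosed_closedBall hB hG
  rw [setIntegral_congr_fun measurableSet_closedBall (fun y hy => (dv_congr (h2 y hy)).symm),
    gauss_global hn h1 c hR]
  apply SI_congr hR.le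
  intro y hy
  rw [(h2 y (sphere_subset_closedBall hy)).self_of_nhds]

theorem gauss_annulus {n : ℕ} (hn : 3 ≤ n) {G : En n → En n} {U : Set (En n)} (hU : IsOpen U)
    (hG : ContDiffOn ℝ 1 G U) (c₁ c₂ : En n) {R₁ R₂ : ℝ} (hR₁ : 0 < R₁) (hR₂ : 0 < R₂)
    (h12 : closedBall c₁ R₁ ⊆ ball c₂ R₂) (hB : closedBall c₂ R₂ \ ball c₁ R₁ ⊆ U) :
    ∫ y in closedBall c₂ R₂ \ closedBall c₁ R₁, dv G y =
      SI (fun y => ⟪G y, y - c₂⟫ / R₂) c₂ R₂ - SI (fun y => ⟪G y, y - c₁⟫ / R₁) c₁ R₁ := by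
  obtain ⟨G', h1, h2⟩ := exists_ext hU (isClosed_closedBall.sdiff isOpen_ball) hB hG
  rw [setIntegral_congr_fun (measurableSet_closedBall.diff measurableSet_closedBall) 
    (fun y hy => (dv_congr (h2 y ⟨hy.1, fun h => hy.2 (ball_subset_closedBall h)⟩)).symm)]
  have hi : ∀ c R, IntegrableOn (dv G') (closedBall c R) := fun c R =>
    ((dv_continuousOn isOpen_univ h1.contDiffOn).mono (subset_univ _)).integrableOn_compact (isCompact_closedBall _ _)
  rw [setIntegral_sdiff measurableSet_closedBall (hi _ _) (h12.trans ball_subset_closedBall), 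
    gauss_global hn h1 c₁ hR₁, gauss_global hn h1 c₂ hR₂]
  congr 1
  · apply SI_congr hR₂.le
    intro y hy
    rw [(h2 y ⟨sphere_subset_closedBall hy, fun h => ?_⟩).self_of_nhds]
    have := h12 (ball_subset_closedBall h)
    rw [mem_ball] at this
    rw [mem_sphere] at hy
    linarith
  · apply SI_congr hR₁.le
    intro y hy
    rw [(h2 y ⟨ball_subset_closedBall (h12 (sphere_subset_closedBall hy)), fun h => ?_⟩).self_of_nhds]
    rw [mem_ball] at h
    rw [mem_sphere] at hy
    linarith

/-- Trace of an endomorphism. -/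
def trc {n : ℕ} (A : En n →L[ℝ] En n) : ℝ :=
  ∑ i : Fin n, ⟪A (EuclideanSpace.single i 1), EuclideanSpace.single i 1⟫

theorem sum_basis {n : ℕ} (v w : En n) :
    ∑ i : Fin n, ⟪v, EuclideanSpace.single i 1⟫ * ⟪(EuclideanSpace.single i 1 : En n), w⟫ = ⟪v, w⟫ := by
  have := (EuclideanSpace.basisFun (Fin n) ℝ).sum_inner_mul_inner v w
  simpa only [EuclideanSpace.basisFun_apply] using this

theorem dv_eq_trc {n : ℕ} {G : En n → En n} {A : En n →L[ℝ] En n} {y : En n} (h : HasFDerivAt G A y) :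
    dv G y = trc A := by
  unfold dv trc; rw [h.fderiv]

theorem dv_smul {n : ℕ} {φ : En n → ℝ} {G : En n → En n} {φ' : En n →L[ℝ] ℝ} {A : En n →L[ℝ] En n} {y : En n}
    (hφ : HasFDerivAt φ φ' y) (h : HasFDerivAt G A y) :
    dv (fun y => φ y • G y) y = φ' (G y) + φ y * trc A := by
  have h1 := hφ.fun_smul h
  rw [dv_eq_trc h1]
  unfold trc
  have h2 : ∀ w, φ' w = ⟪(InnerProductSpace.toDual ℝ (En n)).symm φ', w⟫ := by
    intro w; rw [InnerProductSpace.toDual_symm_apply]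
  rw [h2 (G y), ← sum_basis, Finset.mul_sum, ← Finset.sum_add_distrib]
  refine Finset.sum_congr rfl fun i _ => ?_
  rw [← h2]
  simp only [add_apply, smul_apply, ContinuousLinearMap.smulRight_apply,
    inner_add_left, inner_smul_left, conj_trivial, real_inner_comm (G y)]
  ring

theorem dv_add {n : ℕ} {G G' : En n → En n} {y : En n} (h : DifferentiableAt ℝ G y) (h' : DifferentiableAt ℝ G' y) :
    dv (fun y => G y + G' y) y = dv G y + dv G' y := by
  unfold dv
  rw [fderiv_fun_add h h', ← Finset.sum_add_distrib]
  refine Finset.sum_congr rfl fun i _ => ?_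
  simp [inner_add_left]

theorem dv_sub {n : ℕ} {G G' : En n → En n} {y : En n} (h : DifferentiableAt ℝ G y) (h' : DifferentiableAt ℝ G' y) :
    dv (fun y => G y - G' y) y = dv G y - dv G' y := by
  unfold dv
  rw [fderiv_fun_sub h h', ← Finset.sum_sub_distrib]
  refine Finset.sum_congr rfl fun i _ => ?_
  simp [inner_sub_left]

def lam {n : ℕ} (p b y : En n) : ℝ := 1 - 2 * ⟪b, y - p⟫

def XX {n : ℕ} (p b y : En n) : En n := lam p b y • (y - p) + ‖y - p‖ ^ 2 • b

def QQ {n : ℕ} (p b y : En n) : ℝ := 1 - 2 * ⟪b, y - p⟫ + ‖b‖ ^ 2 * ‖y - p‖ ^ 2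

theorem XX_normSq {n : ℕ} (p b y : En n) : ‖XX p b y‖ ^ 2 = ‖y - p‖ ^ 2 * QQ p b y := by
  unfold XX QQ lam
  rw [norm_add_sq_real, norm_smul, norm_smul, inner_smul_left, inner_smul_right, real_inner_comm b (y - p)]
  simp only [conj_trivial, mul_pow, Real.norm_eq_abs, sq_abs]
  ring

theorem lam_deriv {n : ℕ} (p b y : En n) : ∃ L : En n →L[ℝ] ℝ, HasFDerivAt (lam p b) L y ∧ 
    ∀ w, L w = -2 * ⟪b, w⟫ := by
  have h := ((hasFDerivAt_const b y).inner ℝ (hasFDerivAt_sub_const (x := y) p)).const_mul 2 |>.const_sub 1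
  refine ⟨_, h, fun w => ?_⟩
  simp

theorem nsq_deriv {n : ℕ} (p y : En n) : ∃ L : En n →L[ℝ] ℝ, HasFDerivAt (fun y => ‖y - p‖ ^ 2) L y ∧ 
    ∀ w, L w = 2 * ⟪y - p, w⟫ := by
  have h := (hasFDerivAt_sub_const (x := y) p).norm_sq
  refine ⟨_, h, fun w => ?_⟩
  simp [inner_sub_left]

theorem XX_deriv {n : ℕ} (p b y : En n) : ∃ A : En n →L[ℝ] En n, HasFDerivAt (XX p b) A y ∧ 
    (∀ w, A w = lam p b y • w - (2 * ⟪b, w⟫) • (y - p) + (2 * ⟪y - p, w⟫) • b) ∧ trc A = n * lam p b y := by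
  obtain ⟨L, hL, hL'⟩ := lam_deriv p b y
  obtain ⟨M, hM, hM'⟩ := nsq_deriv p y
  have h := (hL.fun_smul (hasFDerivAt_sub_const (x := y) p)).fun_add (hM.fun_smul (hasFDerivAt_const b y))
  have hA : ∀ w, (lam p b y • ContinuousLinearMap.id ℝ (En n) + L.smulRight (y - p)
    + (‖y - p‖ ^ 2 • (0 : En n →L[ℝ] En n) + M.smulRight b)) w = lam p b y • w - (2 * ⟪b, w⟫) • (y - p) + (2 * ⟪y - p, w⟫) • b := by
    intro w
    simp [hL', hM']
    module
  refine ⟨_, h, hA, ?_⟩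
  unfold trc
  rw [Finset.sum_congr rfl (g := fun _ => lam p b y)]
  · simp
  intro i _
  rw [hA]
  generalize lam p b y = l
  generalize y - p = z
  have : ⟪(EuclideanSpace.single i 1 : En n), EuclideanSpace.single i 1⟫ = (1:ℝ) := by simp
  simp only [inner_add_left, inner_sub_left, inner_smul_left, conj_trivial, this]
  ring

theorem two_le_topp : (2 : WithTop ℕ∞) ≤ ((⊤ : ℕ∞) : WithTop ℕ∞) := 
  WithTop.coe_le_coe.2 (le_top : (2:ℕ∞) ≤ ⊤)

section sol
variable {n : ℕ} {u : En n → ℝ} {U : Set (En n)}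

theorem two_star_sub (hn : 3 ≤ n) : 2 * (n : ℝ) / ((n : ℝ) - 2) - 2 = 4 / ((n : ℝ) - 2) := by
  have : (3:ℝ) ≤ n := by exact_mod_cast hn
  have : (n:ℝ) - 2 ≠ 0 := by linarith
  field_simp; ring

theorem one_lt_two_star (hn : 3 ≤ n) : 1 < 2 * (n : ℝ) / ((n : ℝ) - 2) := by
  have : (3:ℝ) ≤ n := by exact_mod_cast hn
  rw [lt_div_iff₀ (by linarith)]; linarith

theorem u_deriv (hU : IsOpen U) (hu : ContDiffOn ℝ (⊤ : ℕ∞) u U) {y : En n} (hy : y ∈ U) :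
    ∃ L : En n →L[ℝ] ℝ, HasFDerivAt u L y ∧ ∀ w, L w = ⟪gradient u y, w⟫ := by
  have h := (hu.contDiffAt (hU.mem_nhds hy)).differentiableAt (by simp)
  refine ⟨_, h.hasFDerivAt, fun w => ?_⟩
  rw [inner_gradient_left]

theorem grad_contDiffOn (hU : IsOpen U) (hu : ContDiffOn ℝ (⊤ : ℕ∞) u U) : ContDiffOn ℝ 1 (gradient u) U := by
  have h : ContDiffOn ℝ 1 (fderiv ℝ u) U := hu.fderiv_of_isOpen hU (by rw [one_add_one_eq_two]; exact two_le_topp)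
  exact (InnerProductSpace.toDual ℝ (En n)).symm.contDiff.comp_contDiffOn h

theorem grad_deriv (hU : IsOpen U) (hu : ContDiffOn ℝ (⊤ : ℕ∞) u U) {y : En n} (hy : y ∈ U) :
    ∃ H : En n →L[ℝ] En n, HasFDerivAt (gradient u) H y ∧ (∀ v w, ⟪H v, w⟫ = ⟪H w, v⟫) ∧ trc H = lap u y := by
  have hd : DifferentiableAt ℝ (gradient u) y := 
    ((grad_contDiffOn hU hu).contDiffAt (hU.mem_nhds hy)).differentiableAt one_ne_zero
  have hF : ContDiffOn ℝ 1 (fderiv ℝ u) U := hu.fderiv_of_isOpen hU (by rw [one_add_one_eq_two]; exact two_le_topp)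
  have hfd : DifferentiableAt ℝ (fderiv ℝ u) y := (hF.contDiffAt (hU.mem_nhds hy)).differentiableAt one_ne_zero
  have key : ∀ v w, ⟪fderiv ℝ (gradient u) y v, w⟫ = fderiv ℝ (fderiv ℝ u) y v w := by
    intro v w
    have h1 := (hd.hasFDerivAt.inner ℝ (hasFDerivAt_const w y)).fderiv
    have h2 : (fun t => ⟪gradient u t, w⟫) = fun t => fderiv ℝ u t w := by
      ext t; rw [inner_gradient_left]
    rw [h2] at h1
    have h3 := (hfd.hasFDerivAt.clm_apply (hasFDerivAt_const w y)).fderiv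
    rw [h1] at h3
    have := DFunLike.congr_fun h3 v
    simpa using this
  refine ⟨_, hd.hasFDerivAt, ?_, ?_⟩
  · intro v w
    rw [key, key]
    exact ((hu.contDiffAt (hU.mem_nhds hy)).isSymmSndFDerivAt (by simpa using two_le_topp)) v w
  · unfold trc lap
    refine Finset.sum_congr rfl fun i _ => ?_
    rw [key]
    have h3 := (hfd.hasFDerivAt.clm_apply (hasFDerivAt_const (EuclideanSpace.single i 1 : En n) y)).fderiv
    rw [h3]; simp

/-- the energy density -/
def eD (n : ℕ) (u : En n → ℝ) (y : En n) : ℝ :=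
  (1 : ℝ) / 2 * ‖gradient u y‖ ^ 2
        - ((n : ℝ) - 2) / (2 * n) * |u y| ^ (2 * (n : ℝ) / ((n : ℝ) - 2))

theorem eD_deriv (hn : 3 ≤ n) (hU : IsOpen U) (hu : ContDiffOn ℝ (⊤ : ℕ∞) u U) {y : En n} (hy : y ∈ U) 
    {H : En n →L[ℝ] En n} (hH : HasFDerivAt (gradient u) H y) :
    ∃ L : En n →L[ℝ] ℝ, HasFDerivAt (eD n u) L y ∧ 
      ∀ w, L w = ⟪H w, gradient u y⟫ - u y * |u y| ^ ((4:ℝ) / ((n:ℝ) - 2)) * ⟪gradient u y, w⟫ := by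
  obtain ⟨M, hM, hM'⟩ := u_deriv hU hu hy
  have h1 := hH.norm_sq.const_mul ((1:ℝ) / 2)
  have h2 := ((hasDerivAt_abs_rpow (u y) (one_lt_two_star hn)).comp_hasFDerivAt y hM).const_mul (((n : ℝ) - 2) / (2 * n))
  refine ⟨_, h1.sub h2, fun w => ?_⟩
  have : (3:ℝ) ≤ n := by exact_mod_cast hn
  have h3 : (n:ℝ) - 2 ≠ 0 := by linarith
  have h4 : (n:ℝ) ≠ 0 := by linarith
  simp only [sub_apply, smul_apply, ContinuousLinearMap.comp_apply, innerSL_apply_apply, smul_eq_mul, hM',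
    two_star_sub hn, real_inner_comm (H w) (gradient u y)]
  field_simp
  simp
  ring
end sol

section sol2
variable {n : ℕ} {u : En n → ℝ} {U : Set (En n)}

def sS (n : ℕ) (u : En n → ℝ) (p b y : En n) : ℝ :=
  ⟪XX p b y, gradient u y⟫ + ((n : ℝ) - 2) / 2 * (lam p b y * u y)

def PP (n : ℕ) (u : En n → ℝ) (p b y : En n) : En n :=
  eD n u y • XX p b y - sS n u p b y • gradient u y - (((n : ℝ) - 2) / 2 * u y ^ 2) • b

def tt {n : ℕ} (p b y : En n) : ℝ := 1 / 2 * (Real.log (‖y - p‖ ^ 2) - Real.log (QQ p b y))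

def WW (n : ℕ) (u : En n → ℝ) (p b y : En n) : En n :=
  tt p b y • PP n u p b y - (((n : ℝ) - 2) / 4 * (lam p b y * u y ^ 2 / ‖XX p b y‖ ^ 2)) • XX p b y

theorem mul_abs_rpow (hn : 3 ≤ n) (t : ℝ) : t * |t| ^ ((4:ℝ) / ((n:ℝ) - 2)) * t = |t| ^ (2 * (n : ℝ) / ((n : ℝ) - 2)) := by
  have : (3:ℝ) ≤ n := by exact_mod_cast hn
  have h2 : 0 < (4:ℝ) / ((n:ℝ) - 2) := div_pos (by norm_num) (by linarith)
  have : 2 * (n : ℝ) / ((n : ℝ) - 2) = 4 / ((n : ℝ) - 2) + 2 := by rw [← two_star_sub hn]; ring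
  rw [this, Real.rpow_add_of_nonneg (abs_nonneg _) h2.le (by norm_num), Real.rpow_two, sq_abs]
  ring

theorem usq_deriv (hU : IsOpen U) (hu : ContDiffOn ℝ (⊤ : ℕ∞) u U) {y : En n} (hy : y ∈ U) :
    ∃ L : En n →L[ℝ] ℝ, HasFDerivAt (fun y => u y ^ 2) L y ∧ ∀ w, L w = 2 * u y * ⟪gradient u y, w⟫ := by
  obtain ⟨M, hM, hM'⟩ := u_deriv hU hu hy
  refine ⟨_, hM.pow 2, fun w => ?_⟩
  simp [hM']

theorem PP_dv (hn : 3 ≤ n) (hU : IsOpen U) (hu : IsYamabeSol n U u) (p b : En n) {y : En n} (hy : y ∈ U) :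
    DifferentiableAt ℝ (PP n u p b) y ∧ dv (PP n u p b) y = 0 := by
  obtain ⟨hu, heq⟩ := hu
  obtain ⟨H, hH, hsym, htr⟩ := grad_deriv hU hu hy
  obtain ⟨M, hM, hM'⟩ := u_deriv hU hu hy
  obtain ⟨E, hE, hE'⟩ := eD_deriv hn hU hu hy hH
  obtain ⟨A, hA, hA', hAt⟩ := XX_deriv p b y
  obtain ⟨L, hL, hL'⟩ := lam_deriv p b y
  obtain ⟨V, hV, hV'⟩ := usq_deriv hU hu hy
  have hs : HasFDerivAt (sS n u p b) _ y := 
    (hA.inner ℝ hH).fun_add ((hL.fun_mul hM).const_mul (((n : ℝ) - 2) / 2))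
  have d1 := hE.fun_smul hA
  have d2 := hs.fun_smul hH
  have d3 := (hV.const_mul (((n : ℝ) - 2) / 2)).fun_smul (hasFDerivAt_const b y)
  refine ⟨((d1.fun_sub d2).fun_sub d3).differentiableAt, ?_⟩
  unfold PP
  rw [dv_sub (d1.fun_sub d2).differentiableAt d3.differentiableAt, dv_sub d1.differentiableAt d2.differentiableAt,
    dv_smul hE hA, dv_smul hs hH, dv_smul (hV.const_mul (((n : ℝ) - 2) / 2)) (hasFDerivAt_const b y), hE', htr, hAt]
  have heq' : lap u y = - (u y * |u y| ^ ((4:ℝ) / ((n:ℝ) - 2))) := by rw [← heq y hy]; ring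
  have hF := mul_abs_rpow hn (u y)
  have t0 : trc (0 : En n →L[ℝ] En n) = 0 := by simp [trc]
  rw [heq', t0]
  simp only [add_apply, smul_apply, ContinuousLinearMap.comp_apply, ContinuousLinearMap.prod_apply,
    fderivInnerCLM_apply, smul_eq_mul, hM', hL', hV', hA', inner_add_left, inner_sub_left, inner_smul_left, conj_trivial]
  rw [real_inner_comm (H (gradient u y)) (XX p b y), hsym (gradient u y) (XX p b y),
    real_inner_comm (XX p b y) (gradient u y), real_inner_comm b (gradient u y), real_inner_self_eq_norm_sq]
  unfold sS eD
  rw [← hF]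
  have : (3:ℝ) ≤ n := by exact_mod_cast hn
  have h4 : (n:ℝ) ≠ 0 := by linarith
  field_simp
  ring

theorem tt_deriv (p b y : En n) (hz : y ≠ p) (hQ : 0 < QQ p b y) : ∃ T : En n →L[ℝ] ℝ, HasFDerivAt (tt p b) T y ∧ 
    ∀ w, T w = ⟪XX p b y, w⟫ / ‖XX p b y‖ ^ 2 := by
  obtain ⟨L, hL, hL'⟩ := lam_deriv p b y
  obtain ⟨M, hM, hM'⟩ := nsq_deriv p y
  have hz0 : ‖y - p‖ ^ 2 ≠ 0 := by
    have : y - p ≠ 0 := sub_ne_zero.2 hz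
    positivity
  have hq : HasFDerivAt (QQ p b) _ y := hL.fun_add (hM.const_mul (‖b‖ ^ 2))
  have h := ((hM.log hz0).fun_sub (hq.log hQ.ne')).const_mul ((1:ℝ) / 2)
  refine ⟨_, h, fun w => ?_⟩
  rw [XX_normSq]
  simp only [sub_apply, add_apply, smul_apply, smul_eq_mul, hL', hM']
  have hQ' : QQ p b y ≠ 0 := hQ.ne'
  have hl : lam p b y = QQ p b y - ‖b‖ ^ 2 * ‖y - p‖ ^ 2 := by unfold lam QQ; ring
  unfold XX
  rw [inner_add_left, inner_smul_left, inner_smul_left, conj_trivial, conj_trivial, hl]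
  have hz1 : ‖y - p‖ ≠ 0 := norm_ne_zero_iff.2 (sub_ne_zero.2 hz)
  field_simp
  ring

theorem XX_ne (p b y : En n) (hz : y ≠ p) (hQ : 0 < QQ p b y) : ‖XX p b y‖ ^ 2 ≠ 0 := by
  rw [XX_normSq]
  have : y - p ≠ 0 := sub_ne_zero.2 hz
  positivity

theorem WW_dv (hn : 3 ≤ n) (hU : IsOpen U) (hu : IsYamabeSol n U u) (p b : En n) {y : En n} (hy : y ∈ U) 
    (hz : y ≠ p) (hQ : 0 < QQ p b y) :
    dv (WW n u p b) y = eD n u y - sS n u p b y ^ 2 / ‖XX p b y‖ ^ 2 := by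
  obtain ⟨hP, hP0⟩ := PP_dv hn hU hu p b hy
  obtain ⟨hu, heq⟩ := hu
  obtain ⟨A, hA, hA', hAt⟩ := XX_deriv p b y
  obtain ⟨L, hL, hL'⟩ := lam_deriv p b y
  obtain ⟨V, hV, hV'⟩ := usq_deriv hU hu hy
  obtain ⟨T, hT, hT'⟩ := tt_deriv p b y hz hQ
  have hN := XX_ne p b y hz hQ
  have d1 := hT.fun_smul hP.hasFDerivAt
  have hφ := ((hL.fun_mul hV).fun_mul ((hasDerivAt_inv hN).comp_hasFDerivAt y hA.norm_sq)).const_mul (((n : ℝ) - 2) / 4)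
  have hφ2 : HasFDerivAt (fun y => ((n : ℝ) - 2) / 4 * (lam p b y * u y ^ 2 / ‖XX p b y‖ ^ 2)) _ y := hφ
  have d2 := hφ2.fun_smul hA
  unfold WW
  rw [dv_sub d1.differentiableAt d2.differentiableAt, dv_smul hT hP.hasFDerivAt, dv_smul hφ2 hA, hT', hAt, 
    ← dv_eq_trc hP.hasFDerivAt, hP0]
  have hXX : ⟪XX p b y, XX p b y⟫ = ‖XX p b y‖ ^ 2 := real_inner_self_eq_norm_sq _
  have hXAX : ⟪XX p b y, A (XX p b y)⟫ = lam p b y * ‖XX p b y‖ ^ 2 := by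
    rw [hA', inner_add_right, inner_sub_right, inner_smul_right, inner_smul_right, inner_smul_right, hXX,
      real_inner_comm b (XX p b y), real_inner_comm (y - p) (XX p b y)]
    ring
  have hXP : ⟪XX p b y, PP n u p b y⟫ = eD n u y * ‖XX p b y‖ ^ 2 - sS n u p b y * ⟪XX p b y, gradient u y⟫
      - (((n : ℝ) - 2) / 2 * u y ^ 2) * ⟪b, XX p b y⟫ := by
    unfold PP
    rw [inner_sub_right, inner_sub_right, inner_smul_right, inner_smul_right, inner_smul_right, hXX, real_inner_comm b]
  rw [hXP]
  simp only [add_apply, smul_apply, ContinuousLinearMap.comp_apply, innerSL_apply_apply, smul_eq_mul, hL', hV', hXAX, 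
    Function.comp_apply]
  rw [real_inner_comm (XX p b y) (gradient u y)]
  unfold sS
  generalize ⟪XX p b y, gradient u y⟫ = G at *
  generalize ⟪b, XX p b y⟫ = B at *
  generalize ‖XX p b y‖ ^ 2 = N at *
  field_simp
  ring

theorem absp_contDiffOn (hn : 3 ≤ n) (hu : ContDiffOn ℝ (⊤ : ℕ∞) u U) : 
    ContDiffOn ℝ 1 (fun y => |u y| ^ (2 * (n : ℝ) / ((n : ℝ) - 2))) U := by
  have h1 : ContDiffOn ℝ 1 u U := hu.of_le (le_trans (by norm_num) two_le_topp)
  exact (contDiff_norm_rpow (E := ℝ) (one_lt_two_star hn)).comp_contDiffOn h1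

theorem XX_contDiff (p b : En n) : ContDiff ℝ 1 (XX p b) := by
  unfold XX lam
  have h1 : ContDiff ℝ 1 (fun y : En n => y - p) := contDiff_id.sub contDiff_const
  exact ((contDiff_const.sub (contDiff_const.mul (contDiff_const.inner ℝ h1))).smul h1).add (((h1.norm_sq ℝ)).smul contDiff_const)

theorem lam_contDiff (p b : En n) : ContDiff ℝ 1 (lam p b) := by
  unfold lam
  have h1 : ContDiff ℝ 1 (fun y : En n => y - p) := contDiff_id.sub contDiff_const
  exact (contDiff_const.sub (contDiff_const.mul (contDiff_const.inner ℝ h1)))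

theorem QQ_contDiff (p b : En n) : ContDiff ℝ 1 (QQ p b) := by
  unfold QQ
  have h1 : ContDiff ℝ 1 (fun y : En n => y - p) := contDiff_id.sub contDiff_const
  exact (contDiff_const.sub (contDiff_const.mul (contDiff_const.inner ℝ h1))).add (contDiff_const.mul (h1.norm_sq ℝ))

theorem u_contDiffOn (hu : ContDiffOn ℝ (⊤ : ℕ∞) u U) : ContDiffOn ℝ 1 u U :=
  hu.of_le (le_trans (by norm_num) two_le_topp)

theorem eD_contDiffOn (hn : 3 ≤ n) (hU : IsOpen U) (hu : ContDiffOn ℝ (⊤ : ℕ∞) u U) : ContDiffOn ℝ 1 (eD n u) U :=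
  (contDiffOn_const.mul ((grad_contDiffOn hU hu).norm_sq ℝ)).sub (contDiffOn_const.mul (absp_contDiffOn hn hu))

theorem sS_contDiffOn (hU : IsOpen U) (hu : ContDiffOn ℝ (⊤ : ℕ∞) u U) (p b : En n) : ContDiffOn ℝ 1 (sS n u p b) U :=
  ((XX_contDiff p b).contDiffOn.inner ℝ (grad_contDiffOn hU hu)).add 
    (contDiffOn_const.mul ((lam_contDiff p b).contDiffOn.mul (u_contDiffOn hu)))

theorem PP_contDiffOn (hn : 3 ≤ n) (hU : IsOpen U) (hu : ContDiffOn ℝ (⊤ : ℕ∞) u U) (p b : En n) : 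
    ContDiffOn ℝ 1 (PP n u p b) U :=
  (((eD_contDiffOn hn hU hu).smul (XX_contDiff p b).contDiffOn).sub 
    ((sS_contDiffOn hU hu p b).smul (grad_contDiffOn hU hu))).sub
    ((contDiffOn_const.mul ((u_contDiffOn hu).pow 2)).smul contDiffOn_const)

theorem WW_contDiffOn (hn : 3 ≤ n) (hU : IsOpen U) (hu : ContDiffOn ℝ (⊤ : ℕ∞) u U) (p b : En n) : 
    ContDiffOn ℝ 1 (WW n u p b) (U ∩ {y | y ≠ p ∧ 0 < QQ p b y}) := by
  have h1 : ContDiff ℝ 1 (fun y : En n => y - p) := contDiff_id.sub contDiff_const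
  have hs : U ∩ {y | y ≠ p ∧ 0 < QQ p b y} ⊆ U := inter_subset_left
  refine ContDiffOn.sub (ContDiffOn.smul (contDiffOn_const.mul (ContDiffOn.sub ((h1.norm_sq ℝ).contDiffOn.log ?_) 
    ((QQ_contDiff p b).contDiffOn.log ?_))) ((PP_contDiffOn hn hU hu p b).mono hs)) 
    (ContDiffOn.smul (contDiffOn_const.mul (ContDiffOn.div ((lam_contDiff p b).contDiffOn.mul 
      (((u_contDiffOn hu).pow 2).mono hs)) ((XX_contDiff p b).norm_sq ℝ).contDiffOn ?_)) (XX_contDiff p b).contDiffOn)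
  · rintro y ⟨_, hz, hQ⟩
    have : y - p ≠ 0 := sub_ne_zero.2 hz
    positivity
  · rintro y ⟨_, hz, hQ⟩; exact hQ.ne'
  · rintro y ⟨_, hz, hQ⟩; exact XX_ne p b y hz hQ

theorem WW_dom_open (hU : IsOpen U) (p b : En n) : IsOpen (U ∩ {y | y ≠ p ∧ 0 < QQ p b y}) :=
  hU.inter (isOpen_ne.inter (isOpen_lt continuous_const (QQ_contDiff p b).continuous))
end sol2

section mono
variable {n : ℕ} {u : En n → ℝ} {U : Set (En n)}

theorem mem_sph (c : En n) {r : ℝ} (hr : 0 ≤ r) (ω : sphere (0 : En n) 1) : c + r • (ω : En n) ∈ sphere c r := by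
  have : ‖(ω : En n)‖ = 1 := by simpa using ω.2
  simp [mem_sphere, dist_eq_norm, norm_smul, this, abs_of_nonneg hr]

theorem SI_integrable {g : En n → ℝ} {c : En n} {r : ℝ} (hr : 0 ≤ r) (hg : ContinuousOn g (sphere c r)) :
    Integrable (fun ω : sphere (0 : En n) 1 => g (c + r • (ω : En n))) (volume : Measure (En n)).toSphere := by
  have : Continuous (fun ω : sphere (0 : En n) 1 => g (c + r • (ω : En n))) :=
    hg.comp_continuous (by fun_prop) (fun ω => mem_sph c hr ω)
  exact this.integrable_of_hasCompactSupport (HasCompactSupport.of_compactSpace _)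

theorem SI_sub {g g' : En n → ℝ} {c : En n} {r : ℝ} (hr : 0 ≤ r) (hg : ContinuousOn g (sphere c r)) 
    (hg' : ContinuousOn g' (sphere c r)) : SI (fun y => g y - g' y) c r = SI g c r - SI g' c r := by
  unfold SI
  rw [integral_sub (SI_integrable hr hg) (SI_integrable hr hg')]; ring

theorem SI_add {g g' : En n → ℝ} {c : En n} {r : ℝ} (hr : 0 ≤ r) (hg : ContinuousOn g (sphere c r)) 
    (hg' : ContinuousOn g' (sphere c r)) : SI (fun y => g y + g' y) c r = SI g c r + SI g' c r := by
  unfold SI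
  rw [integral_add (SI_integrable hr hg) (SI_integrable hr hg')]; ring

theorem SI_mul (k : ℝ) (g : En n → ℝ) (c : En n) (r : ℝ) : SI (fun y => k * g y) c r = k * SI g c r := by
  unfold SI
  rw [integral_const_mul]; ring

theorem SI_mono {g g' : En n → ℝ} {c : En n} {r : ℝ} (hr : 0 ≤ r) (hg : ContinuousOn g (sphere c r)) 
    (hg' : ContinuousOn g' (sphere c r)) (h : ∀ y ∈ sphere c r, g y ≤ g' y) : SI g c r ≤ SI g' c r := by
  unfold SI
  exact mul_le_mul_of_nonneg_left (integral_mono (SI_integrable hr hg) (SI_integrable hr hg') 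
    (fun ω => h _ (mem_sph c hr ω))) (by positivity)

theorem SI_nonneg {g : En n → ℝ} {c : En n} {r : ℝ} (hr : 0 ≤ r) (h : ∀ y ∈ sphere c r, 0 ≤ g y) : 0 ≤ SI g c r := by
  unfold SI
  exact mul_nonneg (by positivity) (integral_nonneg (fun ω => h _ (mem_sph c hr ω)))

/-- compatibility of a ball with a conformal field. -/
def Cmp (p b c : En n) (R : ℝ) : Prop := ‖p - c‖ < R ∧ p - c = (R ^ 2 - ‖p - c‖ ^ 2) • b

theorem Cmp.m_pos {p b c : En n} {R : ℝ} (h : Cmp p b c R) : 0 < R ^ 2 - ‖p - c‖ ^ 2 := by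
  have := h.1
  have := norm_nonneg (p - c)
  nlinarith

theorem Cmp.lam_eq {p b c : En n} {R : ℝ} (h : Cmp p b c R) (y : En n) : 
    (R ^ 2 - ‖p - c‖ ^ 2) * lam p b y = ‖y - p‖ ^ 2 + R ^ 2 - ‖y - c‖ ^ 2 := by
  have e : y - c = (y - p) + (p - c) := by abel
  have h1 : ‖y - c‖ ^ 2 = ‖y - p‖ ^ 2 + 2 * ⟪y - p, p - c⟫ + ‖p - c‖ ^ 2 := by
    rw [e, norm_add_sq_real]
  have h2 : ⟪y - p, p - c⟫ = (R ^ 2 - ‖p - c‖ ^ 2) * ⟪b, y - p⟫ := by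
    conv_lhs => rw [h.2]
    rw [inner_smul_right, real_inner_comm]
  rw [h1, h2]; unfold lam; ring

theorem QQ_eq (p b y : En n) : QQ p b y = lam p b y + ‖b‖ ^ 2 * ‖y - p‖ ^ 2 := by unfold lam QQ; ring

theorem Cmp.lam_pos {p b c : En n} {R : ℝ} (h : Cmp p b c R) {y : En n} (hy : y ∈ closedBall c R) (hz : y ≠ p) :
    0 < lam p b y := by
  have h1 := h.lam_eq y
  have h2 := h.m_pos
  have h3 : ‖y - c‖ ≤ R := by simpa [dist_eq_norm] using hy
  have h4 : 0 < ‖y - p‖ := norm_pos_iff.2 (sub_ne_zero.2 hz)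
  have h5 : 0 ≤ R ^ 2 - ‖y - c‖ ^ 2 := by nlinarith [norm_nonneg (y - c)]
  have : 0 < (R ^ 2 - ‖p - c‖ ^ 2) * lam p b y := by rw [h1]; nlinarith
  exact (pos_iff_pos_of_mul_pos this).1 h2

theorem Cmp.QQ_pos {p b c : En n} {R : ℝ} (h : Cmp p b c R) {y : En n} (hy : y ∈ closedBall c R) (hz : y ≠ p) :
    0 < QQ p b y := by
  rw [QQ_eq]; have := h.lam_pos hy hz; positivity

theorem Cmp.ne {p b c : En n} {R : ℝ} (h : Cmp p b c R) {y : En n} (hy : y ∈ sphere c R) : y ≠ p := by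
  rintro rfl
  have := h.1
  rw [mem_sphere, dist_eq_norm] at hy
  linarith

theorem Cmp.XX_eq {p b c : En n} {R : ℝ} (h : Cmp p b c R) {y : En n} (hy : y ∈ sphere c R) : 
    XX p b y = lam p b y • (y - c) := by
  have h1 := h.lam_eq y
  have h3 : ‖y - c‖ = R := by simpa [dist_eq_norm] using hy
  rw [h3] at h1
  have h4 : ‖y - p‖ ^ 2 = (R ^ 2 - ‖p - c‖ ^ 2) * lam p b y := by linarith
  have e : y - c = (y - p) + (p - c) := by abel
  unfold XX
  rw [e, smul_add, h4, mul_comm, mul_smul]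
  conv_rhs => rw [h.2]
  
theorem Cmp.tt_eq {p b c : En n} {R : ℝ} (h : Cmp p b c R) {y : En n} (hy : y ∈ sphere c R) : 
    tt p b y = 1 / 2 * (Real.log (R ^ 2 - ‖p - c‖ ^ 2) - Real.log (1 + (R ^ 2 - ‖p - c‖ ^ 2) * ‖b‖ ^ 2)) := by
  have h1 := h.lam_eq y
  have h2 := h.m_pos
  have h3 : ‖y - c‖ = R := by simpa [dist_eq_norm] using hy
  rw [h3] at h1
  have h4 : ‖y - p‖ ^ 2 = (R ^ 2 - ‖p - c‖ ^ 2) * lam p b y := by linarith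
  have h5 := h.lam_pos (sphere_subset_closedBall hy) (h.ne hy)
  unfold tt
  have h6 : QQ p b y = lam p b y * (1 + (R ^ 2 - ‖p - c‖ ^ 2) * ‖b‖ ^ 2) := by rw [QQ_eq, h4]; ring
  rw [h6, h4, Real.log_mul h2.ne' h5.ne', Real.log_mul h5.ne' (by positivity)]
  ring

def Et (n : ℕ) (u : En n → ℝ) (c : En n) (R : ℝ) : ℝ := 
  (∫ y in closedBall c R, eD n u y) + ((n : ℝ) - 2) / (4 * R) * SI (fun y => u y ^ 2) c R

theorem PP_SI (hn : 3 ≤ n) (hU : IsOpen U) (hu : IsYamabeSol n U u) (p b c : En n) {R : ℝ} (hR : 0 < R) 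
    (hB : closedBall c R ⊆ U) : SI (fun y => ⟪PP n u p b y, y - c⟫ / R) c R = 0 := by
  rw [← gauss_ball hn hU (PP_contDiffOn hn hU hu.1 p b) c hR hB]
  rw [setIntegral_congr_fun (g := fun _ => (0:ℝ)) isClosed_closedBall.measurableSet 
    (fun y hy => (PP_dv hn hU hu p b (hB hy)).2)]
  simp

theorem WW_SI (hn : 3 ≤ n) (hU : IsOpen U) (hu : IsYamabeSol n U u) {p b c : En n} {R : ℝ} (hR : 0 < R) 
    (hB : closedBall c R ⊆ U) (h : Cmp p b c R) : 
    SI (fun y => ⟪WW n u p b y, y - c⟫ / R) c R = - (((n : ℝ) - 2) / (4 * R) * SI (fun y => u y ^ 2) c R) := by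
  have hs : sphere c R ⊆ U := sphere_subset_closedBall.trans hB
  have hP : ContinuousOn (fun y => ⟪PP n u p b y, y - c⟫ / R) (sphere c R) := 
    ((((PP_contDiffOn hn hU hu.1 p b).continuousOn.mono hs)).inner (by fun_prop)).div_const _
  have hu2 : ContinuousOn (fun y => u y ^ 2) (sphere c R) := ((u_contDiffOn hu.1).continuousOn.mono hs).pow 2
  set t0 := 1 / 2 * (Real.log (R ^ 2 - ‖p - c‖ ^ 2) - Real.log (1 + (R ^ 2 - ‖p - c‖ ^ 2) * ‖b‖ ^ 2)) with ht0
  rw [SI_congr (g' := fun y => t0 * (⟪PP n u p b y, y - c⟫ / R) - ((n : ℝ) - 2) / (4 * R) * u y ^ 2) hR.le]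
  · have c1 : ContinuousOn (fun y => t0 * (⟪PP n u p b y, y - c⟫ / R)) (sphere c R) := continuousOn_const.mul hP
    have c2 : ContinuousOn (fun y => ((n : ℝ) - 2) / (4 * R) * u y ^ 2) (sphere c R) := continuousOn_const.mul hu2
    rw [SI_sub hR.le c1 c2, SI_mul, SI_mul, PP_SI hn hU hu p b c hR hB]
    ring
  · intro y hy
    have h5 := h.lam_pos (sphere_subset_closedBall hy) (h.ne hy)
    have h3 : ‖y - c‖ = R := by simpa [dist_eq_norm] using hy
    unfold WW
    rw [h.tt_eq hy, ← ht0, h.XX_eq hy, inner_sub_left, inner_smul_left, inner_smul_left, inner_smul_left, 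
      real_inner_self_eq_norm_sq, norm_smul, h3, mul_pow, Real.norm_eq_abs, sq_abs]
    simp only [conj_trivial]
    field_simp

theorem Et_annulus (hn : 3 ≤ n) (hU : IsOpen U) (hu : IsYamabeSol n U u) {p b c₁ c₂ : En n} {R₁ R₂ : ℝ} (hR₁ : 0 < R₁) 
    (hR₂ : 0 < R₂) (hB : closedBall c₂ R₂ ⊆ U) (h1 : Cmp p b c₁ R₁) (h2 : Cmp p b c₂ R₂) 
    (h12 : closedBall c₁ R₁ ⊆ ball c₂ R₂) : 
    IntegrableOn (fun y => sS n u p b y ^ 2 / ‖XX p b y‖ ^ 2) (closedBall c₂ R₂ \ closedBall c₁ R₁) ∧ 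
    Et n u c₂ R₂ - Et n u c₁ R₁ = ∫ y in closedBall c₂ R₂ \ closedBall c₁ R₁, sS n u p b y ^ 2 / ‖XX p b y‖ ^ 2 := by
  have h12' : closedBall c₁ R₁ ⊆ closedBall c₂ R₂ := h12.trans ball_subset_closedBall
  have hdom : closedBall c₂ R₂ \ ball c₁ R₁ ⊆ U ∩ {y | y ≠ p ∧ 0 < QQ p b y} := by
    rintro y ⟨hy, hy1⟩
    have hz : y ≠ p := by
      rintro rfl
      exact hy1 (by simpa [dist_eq_norm] using h1.1)
    exact ⟨hB hy, hz, h2.QQ_pos hy hz⟩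
  have hK : IsCompact (closedBall c₂ R₂ \ ball c₁ R₁) := (isCompact_closedBall _ _).diff isOpen_ball
  have hsub : closedBall c₂ R₂ \ closedBall c₁ R₁ ⊆ closedBall c₂ R₂ \ ball c₁ R₁ := 
    sdiff_subset_sdiff_right ball_subset_closedBall
  have hc : ContinuousOn (fun y => sS n u p b y ^ 2 / ‖XX p b y‖ ^ 2) (closedBall c₂ R₂ \ ball c₁ R₁) := by
    refine ContinuousOn.div (((sS_contDiffOn hU hu.1 p b).continuousOn.mono (hdom.trans inter_subset_left)).pow 2) 
      ((XX_contDiff p b).continuous.norm.pow 2).continuousOn ?_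
    intro y hy
    exact XX_ne p b y (hdom hy).2.1 (hdom hy).2.2
  have hi := (hc.integrableOn_compact hK).mono_set hsub (μ := volume)
  have hce : ContinuousOn (eD n u) (closedBall c₂ R₂) := (eD_contDiffOn hn hU hu.1).continuousOn.mono hB
  have hie := hce.integrableOn_compact (isCompact_closedBall _ _) (μ := volume)
  refine ⟨hi, ?_⟩
  have hg := gauss_annulus hn (WW_dom_open hU p b) (WW_contDiffOn hn hU hu.1 p b) c₁ c₂ hR₁ hR₂ h12 hdom
  rw [WW_SI hn hU hu hR₂ hB h2, WW_SI hn hU hu hR₁ (h12'.trans hB) h1] at hg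
  have hm : MeasurableSet (closedBall c₂ R₂ \ closedBall c₁ R₁) := 
    isClosed_closedBall.measurableSet.diff isClosed_closedBall.measurableSet
  rw [setIntegral_congr_fun hm (g := fun y => eD n u y - sS n u p b y ^ 2 / ‖XX p b y‖ ^ 2) (fun y hy => 
    WW_dv hn hU hu p b (hdom (hsub hy)).1 (hdom (hsub hy)).2.1 (hdom (hsub hy)).2.2), 
    integral_sub (hie.mono_set sdiff_subset) hi, 
    setIntegral_sdiff isClosed_closedBall.measurableSet hie h12'] at hg
  unfold Et
  linarith

theorem Et_mono (hn : 3 ≤ n) (hU : IsOpen U) (hu : IsYamabeSol n U u) {p b c₁ c₂ : En n} {R₁ R₂ : ℝ} (hR₁ : 0 < R₁) 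
    (hR₂ : 0 < R₂) (hB : closedBall c₂ R₂ ⊆ U) (h1 : Cmp p b c₁ R₁) (h2 : Cmp p b c₂ R₂) 
    (h12 : closedBall c₁ R₁ ⊆ ball c₂ R₂) : Et n u c₁ R₁ ≤ Et n u c₂ R₂ := by
  have := (Et_annulus hn hU hu hR₁ hR₂ hB h1 h2 h12).2
  have h : 0 ≤ ∫ y in closedBall c₂ R₂ \ closedBall c₁ R₁, sS n u p b y ^ 2 / ‖XX p b y‖ ^ 2 := 
    integral_nonneg fun y => by positivity
  linarith

theorem exists_Cmp {x x₀ : En n} {r r₀ : ℝ} (hr : 0 < r) (h : ‖x - x₀‖ + r < r₀) : 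
    ∃ p b : En n, Cmp p b x r ∧ Cmp p b x₀ r₀ := by
  rcases eq_or_ne x x₀ with rfl | hne
  · refine ⟨x, 0, ?_, ?_⟩ <;> simp [Cmp]
    · exact hr
    · simp at h; linarith
  set D := ‖x - x₀‖ with hD
  have hD0 : 0 < D := norm_pos_iff.2 (sub_ne_zero.2 hne)
  obtain ⟨s, hs, hs0⟩ : ∃ s ∈ Icc D (D + r), D * s ^ 2 - (r₀ ^ 2 + D ^ 2 - r ^ 2) * s + r₀ ^ 2 * D = 0 := by
    have hc : ContinuousOn (fun s : ℝ => D * s ^ 2 - (r₀ ^ 2 + D ^ 2 - r ^ 2) * s + r₀ ^ 2 * D) (Icc D (D + r)) := by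
      fun_prop
    have := intermediate_value_Icc' (by linarith : D ≤ D + r) hc
    have h0 : (0:ℝ) ∈ Icc (D * (D + r) ^ 2 - (r₀ ^ 2 + D ^ 2 - r ^ 2) * (D + r) + r₀ ^ 2 * D)
      (D * D ^ 2 - (r₀ ^ 2 + D ^ 2 - r ^ 2) * D + r₀ ^ 2 * D) := by
      constructor
      · have : D * (D + r) ^ 2 - (r₀ ^ 2 + D ^ 2 - r ^ 2) * (D + r) + r₀ ^ 2 * D = - (r * ((r₀ - (D + r)) * (r₀ + (D + r)))) := by ring
        rw [this]
        have : 0 < r₀ - (D + r) := by linarith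
        have : 0 < r₀ + (D + r) := by linarith
        have : 0 < r * ((r₀ - (D + r)) * (r₀ + (D + r))) := by positivity
        linarith
      · have : D * D ^ 2 - (r₀ ^ 2 + D ^ 2 - r ^ 2) * D + r₀ ^ 2 * D = D * r ^ 2 := by ring
        rw [this]; positivity
    obtain ⟨s, hs, hs'⟩ := this h0
    exact ⟨s, hs, hs'⟩
  have hs1 : s < D + r := by
    rcases hs.2.lt_or_eq with h' | h'
    · exact h'
    · exfalso
      rw [h'] at hs0
      have : D * (D + r) ^ 2 - (r₀ ^ 2 + D ^ 2 - r ^ 2) * (D + r) + r₀ ^ 2 * D = - (r * ((r₀ - (D + r)) * (r₀ + (D + r)))) := by ring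
      rw [this] at hs0
      have : 0 < r₀ - (D + r) := by linarith
      have : 0 < r₀ + (D + r) := by linarith
      have : 0 < r * ((r₀ - (D + r)) * (r₀ + (D + r))) := by positivity
      linarith
  have hs2 := hs.1
  have hspos : 0 < s := by linarith
  set e := (D⁻¹) • (x - x₀) with he
  have hen : ‖e‖ = 1 := by rw [he, norm_smul, ← hD, norm_inv, Real.norm_eq_abs, abs_of_pos hD0]; field_simp
  have hxe : x = x₀ + D • e := by rw [he, smul_smul, mul_inv_cancel₀ hD0.ne']; simp
  clear_value e
  clear he
  have hp1 : x₀ + s • e - x₀ = s • e := by abel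
  have hp2 : x₀ + s • e - x = (s - D) • e := by
    rw [sub_smul]; conv_lhs => rw [hxe]
    abel
  have hn1 : ‖x₀ + s • e - x₀‖ = s := by rw [hp1, norm_smul, hen, Real.norm_eq_abs, abs_of_pos hspos, mul_one]
  have hn2 : ‖x₀ + s • e - x‖ = s - D := by
    rw [hp2, norm_smul, hen, Real.norm_eq_abs, abs_of_nonneg (by linarith), mul_one]
  have hm1 : 0 < r₀ ^ 2 - s ^ 2 := by nlinarith
  have hm2 : 0 < r ^ 2 - (s - D) ^ 2 := by nlinarith
  refine ⟨x₀ + s • e, (s / (r₀ ^ 2 - s ^ 2)) • e, ⟨by rw [hn2]; linarith, ?_⟩, ⟨by rw [hn1]; linarith, ?_⟩⟩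
  · rw [hn2, hp2, smul_smul]
    congr 1
    field_simp
    linarith
  · rw [hn1, hp1, smul_smul]
    congr 1
    field_simp

theorem Et_le_Eu (hn : 3 ≤ n) (hu : IsYamabeSol n U u) {c : En n} {R : ℝ} (hR : 0 < R) (hB : closedBall c R ⊆ U) : 
    Et n u c R ≤ Eu n u c R := by
  have hs : sphere c R ⊆ U := sphere_subset_closedBall.trans hB
  have : (3:ℝ) ≤ n := by exact_mod_cast hn
  have h := SI_le_hausdorff hn (fun y => u y ^ 2) c hR (fun y => by positivity) 
    (((u_contDiffOn hu.1).continuousOn.mono hs).pow 2)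
  have h2 : 0 ≤ ((n : ℝ) - 2) / (4 * R) := div_nonneg (by linarith) (by positivity)
  have := mul_le_mul_of_nonneg_left h h2
  unfold Et Eu eD
  linarith

theorem Et_le (hn : 3 ≤ n) (hU : IsOpen U) (hu : IsYamabeSol n U u) {x x₀ : En n} {r r₀ ε : ℝ} (hr : 0 < r) 
    (h : ‖x - x₀‖ + r < r₀) (hB : closedBall x₀ r₀ ⊆ U) (hE : Eu n u x₀ r₀ ≤ ε) : Et n u x r ≤ ε := by
  have hr₀ : 0 < r₀ := by linarith [norm_nonneg (x - x₀)]
  obtain ⟨p, b, h1, h2⟩ := exists_Cmp hr h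
  have := Et_mono hn hU hu hr hr₀ hB h1 h2 (closedBall_subset_ball' (by rw [dist_eq_norm]; linarith))
  have := Et_le_Eu hn hu hr₀ hB
  linarith

end mono

section fin
variable {n : ℕ} {u : En n → ℝ} {U : Set (En n)}

def ww (n : ℕ) (u : En n → ℝ) (y : En n) : ℝ := |u y| ^ (2 * (n : ℝ) / ((n : ℝ) - 2))

def FF (n : ℕ) (u : En n → ℝ) (x : En n) (R : ℝ) : ℝ := ∫ y in closedBall x R, ww n u y

def qq (n : ℕ) (u : En n → ℝ) (x y : En n) : ℝ := sS n u x 0 y ^ 2 / ‖XX x 0 y‖ ^ 2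

theorem ww_nonneg (y : En n) : 0 ≤ ww n u y := by unfold ww; positivity

theorem XX_zero (x y : En n) : XX x 0 y = y - x := by simp [XX, lam]

theorem sS_zero (x y : En n) : sS n u x 0 y = ⟪y - x, gradient u y⟫ + ((n : ℝ) - 2) / 2 * u y := by
  simp [sS, XX_zero, lam]

theorem Cmp_zero (x : En n) {R : ℝ} (hR : 0 < R) : Cmp x 0 x R := by simp [Cmp, hR]

theorem ww_cont (hn : 3 ≤ n) (hu : IsYamabeSol n U u) : ContinuousOn (ww n u) U := 
  (absp_contDiffOn hn hu.1).continuousOn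

theorem ww_int (hn : 3 ≤ n) (hu : IsYamabeSol n U u) {x : En n} {R : ℝ} (hB : closedBall x R ⊆ U) : 
    IntegrableOn (ww n u) (closedBall x R) := 
  ((ww_cont hn hu).mono hB).integrableOn_compact (isCompact_closedBall _ _)

theorem grad_int (hU : IsOpen U) (hu : IsYamabeSol n U u) {x : En n} {R : ℝ} (hB : closedBall x R ⊆ U) : 
    IntegrableOn (fun y => ‖gradient u y‖ ^ 2) (closedBall x R) := 
  (((grad_contDiffOn hU hu.1).continuousOn.mono hB).norm.pow 2).integrableOn_compact (isCompact_closedBall _ _)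

theorem eD_int (hn : 3 ≤ n) (hU : IsOpen U) (hu : IsYamabeSol n U u) {x : En n} {R : ℝ} (hB : closedBall x R ⊆ U) : 
    ∫ y in closedBall x R, eD n u y = 1 / 2 * (∫ y in closedBall x R, ‖gradient u y‖ ^ 2) 
      - ((n : ℝ) - 2) / (2 * n) * FF n u x R := by
  unfold FF
  rw [← integral_const_mul, ← integral_const_mul, ← integral_sub ((grad_int hU hu hB).const_mul _) ((ww_int hn hu hB).const_mul _)]
  rfl

theorem ugrad (hn : 3 ≤ n) (hU : IsOpen U) (hu : IsYamabeSol n U u) {x : En n} {R : ℝ} (hR : 0 < R) (hB : closedBall x R ⊆ U) : 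
    (∫ y in closedBall x R, ‖gradient u y‖ ^ 2) - FF n u x R = SI (fun y => ⟪u y • gradient u y, y - x⟫ / R) x R := by
  rw [← gauss_ball hn hU (G := fun y => u y • gradient u y) ((u_contDiffOn hu.1).smul (grad_contDiffOn hU hu.1)) x hR hB]
  unfold FF
  rw [← integral_sub (grad_int hU hu hB) (ww_int hn hu hB)]
  refine setIntegral_congr_fun isClosed_closedBall.measurableSet (fun y hy => ?_)
  obtain ⟨H, hH, hsym, htr⟩ := grad_deriv hU hu.1 (hB hy)
  obtain ⟨M, hM, hM'⟩ := u_deriv hU hu.1 (hB hy)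
  have heq' : lap u y = - (u y * |u y| ^ ((4:ℝ) / ((n:ℝ) - 2))) := by rw [← hu.2 y (hB hy)]; ring
  rw [dv_smul hM hH, hM', htr, real_inner_self_eq_norm_sq, heq']
  have := mul_abs_rpow hn (u y)
  unfold ww
  rw [← this]
  ring

theorem Et_eq (hn : 3 ≤ n) (hU : IsOpen U) (hu : IsYamabeSol n U u) {x : En n} {R : ℝ} (hR : 0 < R) (hB : closedBall x R ⊆ U) : 
    Et n u x R = FF n u x R / n + SI (fun y => u y * sS n u x 0 y) x R / (2 * R) := by
  have h1 := ugrad hn hU hu hR hB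
  have : (3:ℝ) ≤ n := by exact_mod_cast hn
  have hs : sphere x R ⊆ U := sphere_subset_closedBall.trans hB
  have cu := (u_contDiffOn hu.1).continuousOn.mono hs
  have cg := (grad_contDiffOn hU hu.1).continuousOn.mono hs
  have c1 : ContinuousOn (fun y => ⟪u y • gradient u y, y - x⟫ / R) (sphere x R) := 
    ((cu.smul cg).inner (by fun_prop)).div_const _
  have c2 : ContinuousOn (fun y => ((n : ℝ) - 2) / (2 * R) * u y ^ 2) (sphere x R) := continuousOn_const.mul (cu.pow 2)
  have h2 : SI (fun y => u y * sS n u x 0 y) x R / R = 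
      SI (fun y => ⟪u y • gradient u y, y - x⟫ / R) x R + ((n : ℝ) - 2) / (2 * R) * SI (fun y => u y ^ 2) x R := by
    rw [← SI_mul, ← SI_add hR.le c1 c2, div_eq_inv_mul, ← SI_mul]
    congr 1
    ext y
    rw [sS_zero, inner_smul_left, conj_trivial, real_inner_comm]
    field_simp
  have h3 : SI (fun y => u y * sS n u x 0 y) x R / (2 * R) = 1 / 2 * (SI (fun y => u y * sS n u x 0 y) x R / R) := by
    field_simp
  rw [h3, h2, ← h1]
  unfold Et
  rw [eD_int hn hU hu hB]
  field_simp
  ring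

theorem pohozaev (hn : 3 ≤ n) (hU : IsOpen U) (hu : IsYamabeSol n U u) {x : En n} {R : ℝ} (hR : 0 < R) (hB : closedBall x R ⊆ U) : 
    (((n : ℝ) - 2) / 2) ^ 2 * SI (fun y => u y ^ 2) x R ≤ SI (fun y => sS n u x 0 y ^ 2) x R 
      + ((n : ℝ) - 2) / n * R ^ 2 * SI (ww n u) x R := by
  have h0 := PP_SI hn hU hu x 0 x hR hB
  have : (3:ℝ) ≤ n := by exact_mod_cast hn
  have hs : sphere x R ⊆ U := sphere_subset_closedBall.trans hB
  have cu := (u_contDiffOn hu.1).continuousOn.mono hs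
  have cg := (grad_contDiffOn hU hu.1).continuousOn.mono hs
  have cS := (sS_contDiffOn hU hu.1 x 0).continuousOn.mono hs
  have cw := (ww_cont hn hu).mono hs
  have cP := (PP_contDiffOn hn hU hu.1 x 0).continuousOn.mono hs
  have c1 : ContinuousOn (fun y => (((n : ℝ) - 2) / 2) ^ 2 * u y ^ 2) (sphere x R) := continuousOn_const.mul (cu.pow 2)
  have c2 : ContinuousOn (fun y => sS n u x 0 y ^ 2) (sphere x R) := cS.pow 2
  have c3 : ContinuousOn (fun y => ((n : ℝ) - 2) / n * R ^ 2 * ww n u y) (sphere x R) := continuousOn_const.mul cw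
  have c4 : ContinuousOn (fun y => (2 * R) * (⟪PP n u x 0 y, y - x⟫ / R)) (sphere x R) := 
    continuousOn_const.mul ((cP.inner (by fun_prop)).div_const _)
  have c23 : ContinuousOn (fun y => sS n u x 0 y ^ 2 + ((n : ℝ) - 2) / n * R ^ 2 * ww n u y) (sphere x R) := c2.add c3
  have c234 : ContinuousOn (fun y => sS n u x 0 y ^ 2 + ((n : ℝ) - 2) / n * R ^ 2 * ww n u y + 
    (2 * R) * (⟪PP n u x 0 y, y - x⟫ / R)) (sphere x R) := c23.add c4
  have key := SI_mono hR.le c1 c234 ?_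
  · rw [SI_add hR.le c23 c4, SI_add hR.le c2 c3, SI_mul, SI_mul, SI_mul, h0] at key
    linarith
  · intro y hy
    have h3 : ‖y - x‖ = R := by simpa [dist_eq_norm] using hy
    have hcs : ⟪y - x, gradient u y⟫ ^ 2 ≤ R ^ 2 * ‖gradient u y‖ ^ 2 := by
      have := abs_real_inner_le_norm (y - x) (gradient u y)
      rw [h3] at this
      rw [← mul_pow, ← sq_abs]
      gcongr
    have e : ⟪PP n u x 0 y, y - x⟫ = eD n u y * R ^ 2 - sS n u x 0 y * ⟪y - x, gradient u y⟫ := by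
      unfold PP
      rw [XX_zero, inner_sub_left, inner_sub_left, inner_smul_left, inner_smul_left, smul_zero, inner_zero_left, 
        real_inner_self_eq_norm_sq, h3, real_inner_comm]
      simp
    have e2 : (2 * R) * (⟪PP n u x 0 y, y - x⟫ / R) = 2 * ⟪PP n u x 0 y, y - x⟫ := by field_simp
    rw [e2, e, sS_zero]
    have e3 : eD n u y = 1 / 2 * ‖gradient u y‖ ^ 2 - ((n : ℝ) - 2) / (2 * n) * ww n u y := rfl
    have e4 : ((n : ℝ) - 2) / (2 * n) = 1 / 2 * (((n : ℝ) - 2) / n) := by field_simp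
    rw [e3, e4]
    generalize ⟪y - x, gradient u y⟫ = g at *
    nlinarith

theorem key_est (hn : 3 ≤ n) (hU : IsOpen U) (hu : IsYamabeSol n U u) {x : En n} {R δ : ℝ} (hR : 0 < R) (hδ : 0 < δ) 
    (hB : closedBall x R ⊆ U) : 
    FF n u x R ≤ n * Et n u x R + (n / 2) * (δ + R ^ 2 / (δ * ((n : ℝ) - 2) ^ 2)) * SI (qq n u x) x R 
      + ((n : ℝ) - 2) / 2 * δ * SI (ww n u) x R := by
  have h1 := Et_eq hn hU hu hR hB
  have h2 := pohozaev hn hU hu hR hB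
  have h3n : (3:ℝ) ≤ n := by exact_mod_cast hn
  have hn2 : (n:ℝ) - 2 ≠ 0 := by linarith
  have hs : sphere x R ⊆ U := sphere_subset_closedBall.trans hB
  have cu := (u_contDiffOn hu.1).continuousOn.mono hs
  have cS := (sS_contDiffOn hU hu.1 x 0).continuousOn.mono hs
  have hq : SI (qq n u x) x R = (R ^ 2)⁻¹ * SI (fun y => sS n u x 0 y ^ 2) x R := by
    rw [← SI_mul]
    refine SI_congr hR.le (fun y hy => ?_)
    have h3 : ‖y - x‖ = R := by simpa [dist_eq_norm] using hy
    unfold qq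
    rw [XX_zero, h3, div_eq_inv_mul]
  have c1 : ContinuousOn (fun y => (- R⁻¹) * (u y * sS n u x 0 y)) (sphere x R) := continuousOn_const.mul (cu.mul cS)
  have c2 : ContinuousOn (fun y => (δ * (((n : ℝ) - 2) / 2) ^ 2 * (R ^ 2)⁻¹) * u y ^ 2) (sphere x R) := 
    continuousOn_const.mul (cu.pow 2)
  have c3 : ContinuousOn (fun y => (δ * ((n : ℝ) - 2) ^ 2)⁻¹ * sS n u x 0 y ^ 2) (sphere x R) := 
    continuousOn_const.mul (cS.pow 2)
  have hY := SI_mono hR.le c1 (c2.add c3) ?_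
  · have hY' : SI (fun y => (- R⁻¹) * (u y * sS n u x 0 y)) x R ≤ _ := hY.trans_eq (SI_add hR.le c2 c3)
    rw [SI_mul, SI_mul, SI_mul] at hY'
    rw [hq]
    generalize SI (fun y => sS n u x 0 y ^ 2) x R = A at *
    generalize SI (fun y => u y ^ 2) x R = B at *
    generalize SI (fun y => u y * sS n u x 0 y) x R = D at *
    generalize SI (ww n u) x R = V at *
    have e1 : FF n u x R = n * Et n u x R + n / 2 * ((- R⁻¹) * D) := by rw [h1]; field_simp; ring
    have e2 : δ * (((n : ℝ) - 2) / 2) ^ 2 * (R ^ 2)⁻¹ * B ≤ δ * (R ^ 2)⁻¹ * (A + ((n : ℝ) - 2) / n * R ^ 2 * V) := by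
      have : δ * (((n : ℝ) - 2) / 2) ^ 2 * (R ^ 2)⁻¹ * B = δ * (R ^ 2)⁻¹ * ((((n : ℝ) - 2) / 2) ^ 2 * B) := by ring
      rw [this]
      exact mul_le_mul_of_nonneg_left h2 (by positivity)
    have e3 : n / 2 * ((- R⁻¹) * D) ≤ n / 2 * (δ * (R ^ 2)⁻¹ * (A + ((n : ℝ) - 2) / n * R ^ 2 * V) + (δ * ((n : ℝ) - 2) ^ 2)⁻¹ * A) := 
      mul_le_mul_of_nonneg_left (by linarith) (by positivity)
    rw [e1]
    refine (add_le_add le_rfl e3).trans_eq ?_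
    field_simp
    ring
  · intro y hy
    have : 0 ≤ δ * (((n : ℝ) - 2) / 2 * R⁻¹ * u y + (δ * ((n : ℝ) - 2))⁻¹ * sS n u x 0 y) ^ 2 := by positivity
    have e : δ * (((n : ℝ) - 2) / 2 * R⁻¹ * u y + (δ * ((n : ℝ) - 2))⁻¹ * sS n u x 0 y) ^ 2 = 
      (δ * (((n : ℝ) - 2) / 2) ^ 2 * (R ^ 2)⁻¹) * u y ^ 2 + (δ * ((n : ℝ) - 2) ^ 2)⁻¹ * sS n u x 0 y ^ 2 + R⁻¹ * (u y * sS n u x 0 y) := by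
      field_simp
      ring
    simp only [Pi.add_apply]
    linarith
end fin

section fin2
variable {n : ℕ} {u : En n → ℝ} {U : Set (En n)}

theorem FF_mono (hn : 3 ≤ n) (hu : IsYamabeSol n U u) {x : En n} {ρ R : ℝ} (h : ρ ≤ R) (hB : closedBall x R ⊆ U) : 
    FF n u x ρ ≤ FF n u x R := 
  setIntegral_mono_set (ww_int hn hu hB) (Eventually.of_forall fun y => ww_nonneg y) 
    (Eventually.of_forall (closedBall_subset_closedBall h))

theorem FF_nonneg (x : En n) (R : ℝ) : 0 ≤ FF n u x R := integral_nonneg fun y => ww_nonneg y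

theorem Et_lower (hn : 3 ≤ n) (hU : IsOpen U) (hu : IsYamabeSol n U u) {x : En n} {R : ℝ} (hR : 0 < R) (hB : closedBall x R ⊆ U) : 
    1 / 2 * (∫ y in closedBall x R, ‖gradient u y‖ ^ 2) ≤ Et n u x R + 1 / 2 * FF n u x R := by
  have h3n : (3:ℝ) ≤ n := by exact_mod_cast hn
  unfold Et
  rw [eD_int hn hU hu hB]
  have h1 : 0 ≤ SI (fun y => u y ^ 2) x R := SI_nonneg hR.le fun y _ => by positivity
  have h2 : 0 ≤ ((n : ℝ) - 2) / (4 * R) := div_nonneg (by linarith) (by positivity)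
  have h3 : ((n : ℝ) - 2) / (2 * n) ≤ 1 / 2 := by
    rw [div_le_div_iff₀ (by positivity) (by norm_num)]; linarith
  have := mul_le_mul_of_nonneg_right h3 (FF_nonneg (u := u) x R)
  have := mul_nonneg h2 h1
  linarith

theorem Et_nonneg (hn : 3 ≤ n) (hU : IsOpen U) (hu : IsYamabeSol n U u) {x : En n} {R : ℝ} (hR : 0 < R) (hB : closedBall x R ⊆ U) : 
    0 ≤ Et n u x R := by
  have hp := (polar_ball hn (ww n u) x hR.le (ww_int hn hu hB)).1
  have hc : ContinuousOn (fun t => ∫ s in (0:ℝ)..t, SI (ww n u) x s) (uIcc 0 R) := 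
    intervalIntegral.continuousOn_primitive_interval' hp (by simp)
  have h0 : Tendsto (fun t => ∫ s in (0:ℝ)..t, SI (ww n u) x s) (𝓝[Ioo 0 R] 0) (𝓝 0) := by
    have := (hc 0 (by simp)).mono (s := Ioo 0 R) (by rw [uIcc_of_le hR.le]; exact Ioo_subset_Icc_self)
    simpa [ContinuousWithinAt] using this
  have hne : (𝓝[Ioo 0 R] (0:ℝ)).NeBot := by
    rw [nhdsWithin_Ioo_eq_nhdsGT hR]; infer_instance
  have h1 : Tendsto (fun t => - (1 / 2 * ∫ s in (0:ℝ)..t, SI (ww n u) x s)) (𝓝[Ioo 0 R] 0) (𝓝 0) := by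
    have := (h0.const_mul (1 / 2)).neg
    rwa [mul_zero, neg_zero] at this
  refine le_of_tendsto h1 ?_
  filter_upwards [self_mem_nhdsWithin] with ρ hρ
  have hB' : closedBall x ρ ⊆ U := (closedBall_subset_closedBall hρ.2.le).trans hB
  rw [← (polar_ball hn (ww n u) x hρ.1.le (ww_int hn hu hB')).2]
  have h2 := Et_lower hn hU hu hρ.1 hB'
  have h3 := Et_mono hn hU hu hρ.1 hR hB (Cmp_zero x hρ.1) (Cmp_zero x hR) (closedBall_subset_ball hρ.2)
  have h4 : 0 ≤ ∫ y in closedBall x ρ, ‖gradient u y‖ ^ 2 := integral_nonneg fun y => by positivity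
  unfold FF at h2
  linarith

theorem step (hn : 3 ≤ n) (hU : IsOpen U) (hu : IsYamabeSol n U u) {x : En n} {r ε ρ₁ ρ₂ : ℝ} (hε : 0 < ε) (h1 : 0 < ρ₁) (h12 : ρ₁ < ρ₂)
    (h2 : ρ₂ ≤ r) (hB : closedBall x r ⊆ U) (hE : ∀ R, 0 < R → R ≤ r → Et n u x R ≤ ε) : 
    FF n u x ρ₁ ≤ 1 / 8 * FF n u x ρ₂ + 4 * n * ε * r ^ 2 / (ρ₂ - ρ₁) ^ 2 := by
  have h3n : (3:ℝ) ≤ n := by exact_mod_cast hn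
  have hB2 : closedBall x ρ₂ ⊆ U := (closedBall_subset_closedBall h2).trans hB
  set N : ℝ := (n:ℝ) - 2 with hN
  have hN1 : 1 ≤ N := by linarith
  set g := ρ₂ - ρ₁ with hg
  have hg0 : 0 < g := by linarith
  have hgr : g ≤ r := by linarith
  set δ := g / (4 * N) with hδ
  have hδ0 : 0 < δ := by positivity
  obtain ⟨iq, eq⟩ := Et_annulus hn hU hu h1 (h1.trans h12) hB2 (Cmp_zero x h1) (Cmp_zero x (h1.trans h12)) (closedBall_subset_ball h12)
  obtain ⟨pi, pe⟩ := polar hn (qq n u x) x h1.le h12.le iq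
  obtain ⟨wi, we⟩ := polar hn (ww n u) x h1.le h12.le ((ww_int hn hu hB2).mono_set sdiff_subset)
  have hq : ∫ R in ρ₁..ρ₂, SI (qq n u x) x R ≤ ε := by
    rw [← pe]
    have := hE ρ₂ (h1.trans h12) h2
    have := Et_nonneg hn hU hu h1 ((closedBall_subset_closedBall h12.le).trans hB2)
    have : ∫ y in closedBall x ρ₂ \ closedBall x ρ₁, qq n u x y = Et n u x ρ₂ - Et n u x ρ₁ := eq.symm
    linarith
  have hw : ∫ R in ρ₁..ρ₂, SI (ww n u) x R ≤ FF n u x ρ₂ := by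
    rw [← we]
    exact setIntegral_mono_set (ww_int hn hu hB2) (Eventually.of_forall fun y => ww_nonneg y) 
      (Eventually.of_forall sdiff_subset)
  set K := (n / 2) * (δ + r ^ 2 / (δ * N ^ 2)) with hK
  have hK0 : 0 ≤ K := by positivity
  have hpt : ∀ R ∈ Icc ρ₁ ρ₂, FF n u x ρ₁ ≤ n * ε + K * SI (qq n u x) x R + N / 2 * δ * SI (ww n u) x R := by
    intro R hR
    have hR0 : 0 < R := h1.trans_le hR.1
    have hRr : R ≤ r := hR.2.trans h2
    have hBR : closedBall x R ⊆ U := (closedBall_subset_closedBall hRr).trans hB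
    have k1 := key_est hn hU hu hR0 hδ0 hBR
    have k2 := FF_mono hn hu hR.1 hBR
    have k3 := mul_le_mul_of_nonneg_left (hE R hR0 hRr) (by positivity : (0:ℝ) ≤ n)
    have k4 : 0 ≤ SI (qq n u x) x R := SI_nonneg hR0.le fun y _ => by unfold qq; positivity
    have k5 : (n / 2) * (δ + R ^ 2 / (δ * N ^ 2)) ≤ K := by
      rw [hK]; gcongr
    have k6 := mul_le_mul_of_nonneg_right k5 k4
    linarith
  have ic : IntervalIntegrable (fun _ : ℝ => n * ε) volume ρ₁ ρ₂ := intervalIntegrable_const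
  have ic1 : IntervalIntegrable (fun _ : ℝ => FF n u x ρ₁) volume ρ₁ ρ₂ := intervalIntegrable_const
  have hI := intervalIntegral.integral_mono_on h12.le ic1 ((ic.add (pi.const_mul K)).add 
    (wi.const_mul (N / 2 * δ))) hpt
  have hI2 : ∫ R in ρ₁..ρ₂, (n * ε + K * SI (qq n u x) x R + N / 2 * δ * SI (ww n u) x R) = 
      g * (n * ε) + K * (∫ R in ρ₁..ρ₂, SI (qq n u x) x R) + N / 2 * δ * ∫ R in ρ₁..ρ₂, SI (ww n u) x R := by
    rw [intervalIntegral.integral_add (ic.add (pi.const_mul K)) (wi.const_mul (N / 2 * δ)), 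
      intervalIntegral.integral_add ic (pi.const_mul K), intervalIntegral.integral_const, smul_eq_mul]
    rw [intervalIntegral.integral_const_mul K, intervalIntegral.integral_const_mul (N / 2 * δ)]
  have hI1 : ∫ R in ρ₁..ρ₂, FF n u x ρ₁ = g * FF n u x ρ₁ := by
    rw [intervalIntegral.integral_const, smul_eq_mul]
  have hI3 : g * FF n u x ρ₁ ≤ g * (n * ε) + K * ε + N / 2 * δ * FF n u x ρ₂ := by
    rw [← hI1]
    refine (hI.trans_eq hI2).trans ?_
    gcongr
  have e1 : N / 2 * δ = g * (1 / 8) := by rw [hδ]; field_simp; norm_num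
  have e2 : K ≤ g * (3 * n * (r ^ 2 / g ^ 2)) := by
    have : K = g * (n * (1 / (8 * N) + 2 / N * (r ^ 2 / g ^ 2))) := by
      rw [hK, hδ]; field_simp; ring
    rw [this]
    have a1 : 1 / (8 * N) ≤ 1 := by rw [div_le_one (by positivity)]; linarith
    have a2 : 2 / N ≤ 2 := by rw [div_le_iff₀ (by positivity)]; linarith
    have a3 : 1 ≤ r ^ 2 / g ^ 2 := by
      rw [one_le_div (by positivity)]; gcongr
    have a4 : 1 / (8 * N) + 2 / N * (r ^ 2 / g ^ 2) ≤ 3 * (r ^ 2 / g ^ 2) := by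
      have := mul_le_mul_of_nonneg_right a2 (by positivity : 0 ≤ r ^ 2 / g ^ 2)
      linarith
    have : n * (1 / (8 * N) + 2 / N * (r ^ 2 / g ^ 2)) ≤ n * (3 * (r ^ 2 / g ^ 2)) := by gcongr
    have := mul_le_mul_of_nonneg_left this hg0.le
    linarith
  have e3 := mul_le_mul_of_nonneg_right e2 hε.le
  have a3 : 1 ≤ r ^ 2 / g ^ 2 := by
    rw [one_le_div (by positivity)]; gcongr
  have e4 : (n * ε) ≤ (n * ε) * (r ^ 2 / g ^ 2) := le_mul_of_one_le_right (by positivity) a3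
  have e5 := mul_le_mul_of_nonneg_left e4 hg0.le
  rw [e1] at hI3
  have e6 : g * FF n u x ρ₁ ≤ g * (1 / 8 * FF n u x ρ₂ + 4 * n * ε * r ^ 2 / g ^ 2) := by
    have : 4 * n * ε * r ^ 2 / g ^ 2 = 4 * n * ε * (r ^ 2 / g ^ 2) := by ring
    rw [this]
    generalize r ^ 2 / g ^ 2 = Z at *
    linarith
  exact le_of_mul_le_mul_left e6 hg0

theorem FF_bound (hn : 3 ≤ n) (hU : IsOpen U) (hu : IsYamabeSol n U u) {x : En n} {r ε : ℝ} (hε : 0 < ε) (hr : 0 < r)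
    (hB : closedBall x r ⊆ U) (hE : ∀ R, 0 < R → R ≤ r → Et n u x R ≤ ε) : 
    FF n u x (5 / 9 * r) ≤ 162 * n * ε := by
  set S := (fun ρ => (r - ρ) ^ 2 * FF n u x ρ) '' Ico (r / 2) r with hS
  have hbdd : BddAbove S := by
    refine ⟨r ^ 2 * FF n u x r, ?_⟩
    rintro _ ⟨ρ, hρ, rfl⟩
    have h1 := hρ.1
    have h2 := hρ.2
    have := FF_mono hn hu h2.le hB
    have h0 := FF_nonneg (u := u) x ρ
    have : 0 ≤ r - ρ := by linarith
    simp only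
    gcongr
    linarith
  have hne : S.Nonempty := ⟨_, mem_image_of_mem _ (⟨le_rfl, by linarith⟩ : r / 2 ∈ Ico (r / 2) r)⟩
  have hM : sSup S ≤ 1 / 2 * sSup S + 16 * n * ε * r ^ 2 := by
    refine csSup_le hne ?_
    rintro _ ⟨ρ, hρ, rfl⟩
    have h1 := hρ.1
    have h2 := hρ.2
    have hg : 0 < r - ρ := by linarith
    have hst := step hn hU hu hε (by linarith : 0 < ρ) (by linarith : ρ < (ρ + r) / 2) (by linarith : (ρ + r) / 2 ≤ r) hB hE
    have hmem : (r - (ρ + r) / 2) ^ 2 * FF n u x ((ρ + r) / 2) ≤ sSup S := 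
      le_csSup hbdd (mem_image_of_mem (fun ρ => (r - ρ) ^ 2 * FF n u x ρ) ⟨by linarith, by linarith⟩)
    have e : (ρ + r) / 2 - ρ = (r - ρ) / 2 := by ring
    have e' : r - (ρ + r) / 2 = (r - ρ) / 2 := by ring
    rw [e] at hst
    rw [e'] at hmem
    simp only
    have := mul_le_mul_of_nonneg_left hst (by positivity : 0 ≤ (r - ρ) ^ 2)
    have e2 : (r - ρ) ^ 2 * (1 / 8 * FF n u x ((ρ + r) / 2) + 4 * n * ε * r ^ 2 / ((r - ρ) / 2) ^ 2) = 
      1 / 2 * (((r - ρ) / 2) ^ 2 * FF n u x ((ρ + r) / 2)) + 16 * n * ε * r ^ 2 := by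
      field_simp
      ring
    linarith
  have hm : (r - 5 / 9 * r) ^ 2 * FF n u x (5 / 9 * r) ≤ sSup S := 
    le_csSup hbdd (mem_image_of_mem (fun ρ => (r - ρ) ^ 2 * FF n u x ρ) ⟨by linarith, by linarith⟩)
  have h3 : r ^ 2 * FF n u x (5 / 9 * r) ≤ r ^ 2 * (162 * n * ε) := by nlinarith
  exact le_of_mul_le_mul_left h3 (by positivity)

theorem norm_of_subset (hn : 3 ≤ n) {x x₀ : En n} {r r₀ : ℝ} (hr : 0 < r) (h : closedBall x r ⊆ closedBall x₀ r₀) : 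
    ‖x - x₀‖ + r ≤ r₀ := by
  rcases eq_or_ne x x₀ with rfl | hne
  · have h1e : ‖(EuclideanSpace.single (⟨0, by omega⟩ : Fin n) (1:ℝ) : En n)‖ = 1 := by simp
    have hm : x + r • (EuclideanSpace.single (⟨0, by omega⟩ : Fin n) (1:ℝ) : En n) ∈ closedBall x r := by
      rw [mem_closedBall, dist_eq_norm, add_sub_cancel_left, norm_smul, h1e, Real.norm_eq_abs, abs_of_pos hr, mul_one]
    have := h hm
    rw [mem_closedBall, dist_eq_norm, add_sub_cancel_left, norm_smul, h1e, Real.norm_eq_abs, abs_of_pos hr, mul_one] at this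
    simpa using this
  · have hD : 0 < ‖x - x₀‖ := norm_pos_iff.2 (sub_ne_zero.2 hne)
    have hm : x + (r / ‖x - x₀‖) • (x - x₀) ∈ closedBall x r := by
      rw [mem_closedBall, dist_eq_norm, add_sub_cancel_left, norm_smul, Real.norm_eq_abs, abs_of_pos (by positivity)]
      apply le_of_eq; field_simp
    have := h hm
    have e : x + (r / ‖x - x₀‖) • (x - x₀) - x₀ = (1 + r / ‖x - x₀‖) • (x - x₀) := by
      rw [add_smul, one_smul]; abel
    rw [mem_closedBall, dist_eq_norm, e, norm_smul, Real.norm_eq_abs, abs_of_pos (by positivity)] at this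
    have e2 : (1 + r / ‖x - x₀‖) * ‖x - x₀‖ = ‖x - x₀‖ + r := by field_simp
    linarith
end fin2

/-- there is `C > 0` depending only on `n` such that if `E_u(x₀,r₀) ≤ ε`
on a closed ball `B(x₀,r₀) ⊆ Ω`, then every ball `B(x,r) ⊆ B(x₀,r₀)` satisfies
`∫_{B(x,r/2)} (|∇u|² + |u|^{2n/(n-2)}) ≤ C ε`. -/
theorem small_energy_propagates {n : ℕ} (hn : 3 ≤ n) :
    ∃ C > (0 : ℝ),
      ∀ (Ω : Set (En n)), IsOpen Ω →
      ∀ u : En n → ℝ, IsYamabeSol n Ω u →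
      ∀ (x₀ : En n) (r₀ ε : ℝ), 0 < r₀ → 0 < ε → closedBall x₀ r₀ ⊆ Ω →
      Eu n u x₀ r₀ ≤ ε →
      ∀ (x : En n) (r : ℝ), 0 < r → closedBall x r ⊆ closedBall x₀ r₀ →
      (∫ y in closedBall x (r / 2),
          (‖gradient u y‖ ^ 2 + |u y| ^ (2 * (n : ℝ) / ((n : ℝ) - 2)))) ≤ C * ε := by
  refine ⟨2 + 324 * n, by positivity, ?_⟩
  intro Ω hΩ u hu x₀ r₀ ε hr₀ hε hB hE x r hr hsub
  have hnm := norm_of_subset hn hr hsub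
  have hEt : ∀ R, 0 < R → R ≤ 9 / 10 * r → Et n u x R ≤ ε := fun R hR hRr => 
    Et_le hn hΩ hu hR (by linarith) hB hE
  have hBr : closedBall x (9 / 10 * r) ⊆ Ω := (closedBall_subset_closedBall (by linarith)).trans (hsub.trans hB)
  have hB2 : closedBall x (r / 2) ⊆ Ω := (closedBall_subset_closedBall (by linarith)).trans (hsub.trans hB)
  have h1 := FF_bound hn hΩ hu hε (by positivity : 0 < 9 / 10 * r) hBr hEt
  have e : 5 / 9 * (9 / 10 * r) = r / 2 := by ring
  rw [e] at h1
  have h2 := Et_lower hn hΩ hu (by positivity : 0 < r / 2) hB2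
  have h3 := hEt (r / 2) (by positivity) (by linarith)
  have h4 : ∫ y in closedBall x (r / 2), (‖gradient u y‖ ^ 2 + |u y| ^ (2 * (n : ℝ) / ((n : ℝ) - 2))) = 
      (∫ y in closedBall x (r / 2), ‖gradient u y‖ ^ 2) + FF n u x (r / 2) := 
    integral_add (grad_int hΩ hu hB2) (ww_int hn hu hB2)
  rw [h4]
  linarith

end
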